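/- arXiv:1703.00362 — 4 statements merged into one kernel-verified Lean document; each statement's English description precedes it below -/
import Mathlib

section
/- Let α ≥ 1/3. Then for every function f : ℝ → ℝ of bounded variation, the nontangential maximal function satisfies V(M^α f) ≤ V(f). -/
open MeasureTheory Set Filter Topology

/-- The average of `|f|` over the interval `[y - t, y + t]`. -/
noncomputable def avgAbs (f : ℝ → ℝ) (y t : ℝ) : ℝ :=
  (1 / (2 * t)) * ∫ s in (y - t)..(y + t), |f s|

/-- The nontangential Hardy–Littlewood maximal function
`M^α f (x) = sup { (1/(2t)) ∫_{y-t}^{y+t} |f| : 0 < t, |x - y| ≤ α t }`. -/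
noncomputable def ntMax (α : ℝ) (f : ℝ → ℝ) (x : ℝ) : ℝ :=
  sSup {r : ℝ | ∃ y t : ℝ, 0 < t ∧ |x - y| ≤ α * t ∧ r = avgAbs f y t}

section Variation

/-- The variation of `g` on `(-∞, s]` dominates increments of `g`. -/
theorem abs_sub_le_variation_Iic_sub {g : ℝ → ℝ} (hg : BoundedVariationOn g univ) {s t : ℝ}
    (hst : s ≤ t) :
    |g t - g s| ≤ (eVariationOn g (Iic t)).toReal - (eVariationOn g (Iic s)).toReal := by
  have hfin : ∀ S : Set ℝ, eVariationOn g S ≠ ⊤ := fun S =>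
    ne_top_of_le_ne_top hg (eVariationOn.mono g (subset_univ S))
  have h1 : eVariationOn g (Iic s) + eVariationOn g (Icc s t) ≤ eVariationOn g (Iic t) := by
    rw [← Iic_union_Icc_eq_Iic hst]
    exact eVariationOn.add_le_union g fun x hx y hy => le_trans hx hy.1
  have h2 := BoundedVariationOn.dist_le (f := g) (s := Icc s t) (hfin _)
    (right_mem_Icc.2 hst) (left_mem_Icc.2 hst)
  have h3 := ENNReal.toReal_mono (hfin _) h1
  rw [ENNReal.toReal_add (hfin _) (hfin _)] at h3
  rw [Real.dist_eq] at h2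
  linarith

/-- If `g` takes values at most `h x` arbitrarily close to every `x`, and takes values close to
every peak of `h` between two lower values of `h`, then the variation of `h` is at most that
of `g`. -/
theorem eVariationOn_le_of_peaks {g h : ℝ → ℝ} (hg : BoundedVariationOn g univ)
    (hlow : ∀ x, ∀ q < x, ∀ s > x, ∃ p, q < p ∧ p < s ∧ g p ≤ h x)
    (hpeak : ∀ a x b, a < x → x < b → h a < h x → h b < h x → ∀ ε > 0,
      ∃ s, a < s ∧ s < b ∧ h x - ε ≤ g s)
    (hleft : ∀ x b, x < b → h b < h x → ∀ ε > 0, ∃ s, s < b ∧ h x - ε ≤ g s)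
    (hright : ∀ a x, a < x → h a < h x → ∀ ε > 0, ∃ s, a < s ∧ h x - ε ≤ g s) :
    eVariationOn h univ ≤ eVariationOn g univ := by
  set v : ℝ → ℝ := fun s => (eVariationOn g (Iic s)).toReal
  have hv0 : ∀ s, 0 ≤ v s := fun s => ENNReal.toReal_nonneg
  have hvV : ∀ s, v s ≤ (eVariationOn g univ).toReal := fun s =>
    ENNReal.toReal_mono hg (eVariationOn.mono g (subset_univ _))
  have hinc : ∀ s t, s ≤ t → |g t - g s| ≤ v t - v s := fun s t hst =>
    abs_sub_le_variation_Iic_sub hg hst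
  have hadd : ∀ s t, s ≤ t → v s + g s ≤ v t + g t := fun s t hst => by
    linarith [hinc s t hst, neg_abs_le (g t - g s)]
  have hsub : ∀ s t, s ≤ t → v s - g s ≤ v t - g t := fun s t hst => by
    linarith [hinc s t hst, le_abs_self (g t - g s)]
  refine iSup_le ?_
  rintro ⟨n, u, hu, -⟩
  set S : ℕ → ℝ := fun i => ∑ j ∈ Finset.range i, |h (u (j + 1)) - h (u j)| with hS
  -- Either the sum vanishes, or the last strict move of `h` was downwards, or upwards.
  have key : ∀ i, S i = 0 ∨
      (∀ ε > 0, ∃ s < u i, S i + h (u i) - ε ≤ v s + g s) ∨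
      (∃ a < u i, h a < h (u i) ∧ ∀ s > a, S i - h (u i) ≤ v s - g s) := by
    intro i
    induction i with
    | zero => left; simp [hS]
    | succ i ih =>
      have hSi : S (i + 1) = S i + |h (u (i + 1)) - h (u i)| := Finset.sum_range_succ _ _
      have hle : u i ≤ u (i + 1) := hu (Nat.le_succ i)
      rcases lt_trichotomy (h (u (i + 1))) (h (u i)) with hlt | heq | hgt
      · have hlt' : u i < u (i + 1) := lt_of_le_of_ne hle fun e => by
          rw [e] at hlt; exact lt_irrefl _ hlt
        rw [abs_of_neg (by linarith)] at hSi
        right; left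
        intro ε hε
        rcases ih with h0 | hD | ⟨a, ha, hha, hU⟩
        · obtain ⟨s, hs, hs'⟩ := hleft _ _ hlt' hlt ε hε
          exact ⟨s, hs, by linarith [hv0 s]⟩
        · obtain ⟨s, hs, hs'⟩ := hD ε hε
          exact ⟨s, hs.trans hlt', by linarith⟩
        · obtain ⟨s, has, hsb, hs'⟩ := hpeak a _ _ ha hlt' hha hlt (ε / 2) (by linarith)
          exact ⟨s, hsb, by linarith [hU s has]⟩
      · rw [heq, sub_self, abs_zero, add_zero] at hSi
        rw [hSi, heq]
        rcases ih with h0 | hD | ⟨a, ha, hha, hU⟩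
        · exact Or.inl h0
        · refine Or.inr (Or.inl fun ε hε => ?_)
          obtain ⟨s, hs, hs'⟩ := hD ε hε
          exact ⟨s, hs.trans_le hle, hs'⟩
        · exact Or.inr (Or.inr ⟨a, ha.trans_le hle, hha, hU⟩)
      · have hlt' : u i < u (i + 1) := lt_of_le_of_ne hle fun e => by
          rw [e] at hgt; exact lt_irrefl _ hgt
        rw [abs_of_pos (by linarith)] at hSi
        right; right
        rcases ih with h0 | hD | ⟨a, ha, hha, hU⟩
        · refine ⟨u i, hlt', hgt, fun s hs => ?_⟩
          obtain ⟨p, -, hps, hp⟩ := hlow (u i) (u i - 1) (by linarith) s hs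
          linarith [hsub p s hps.le, hv0 p]
        · refine ⟨u i, hlt', hgt, fun s hs => ?_⟩
          refine le_of_forall_pos_le_add fun ε hε => ?_
          obtain ⟨q, hq, hq'⟩ := hD ε hε
          obtain ⟨p, hqp, hps, hp⟩ := hlow (u i) q hq s hs
          linarith [hsub p s hps.le, hadd q p hqp.le]
        · exact ⟨a, ha.trans hlt', hha.trans hgt, fun s hs => by linarith [hU s hs]⟩
  have hSn : S n ≤ (eVariationOn g univ).toReal := by
    rcases key n with h0 | hD | ⟨a, ha, hha, hU⟩
    · rw [h0]; exact ENNReal.toReal_nonneg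
    · refine le_of_forall_pos_le_add fun ε hε => ?_
      obtain ⟨q, hq, hq'⟩ := hD ε hε
      obtain ⟨p, hqp, -, hp⟩ := hlow (u n) q hq (u n + 1) (by linarith)
      linarith [hadd q p hqp.le, hvV p]
    · refine le_of_forall_pos_le_add fun ε hε => ?_
      obtain ⟨s, hs, hs'⟩ := hright a _ ha hha ε hε
      linarith [hU s hs, hvV s]
  calc ∑ j ∈ Finset.range n, edist (h (u (j + 1))) (h (u j)) = ENNReal.ofReal (S n) := by
        rw [hS, ENNReal.ofReal_sum_of_nonneg fun _ _ => abs_nonneg _]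
        exact Finset.sum_congr rfl fun _ _ => by rw [edist_dist, Real.dist_eq]
    _ ≤ eVariationOn g univ := ENNReal.ofReal_le_of_le_toReal hSn

end Variation

/-- If `g` has large average on `[L, R]`, but average at most `A` on every interval whose middle
third contains `a` (unless `a ≤ L`) or `b` (unless `R ≤ b`), where `a` and `b` lie on the two sides
of the middle third of `[L, R]`, then `g` reaches `A` between `a` and `b`. -/
theorem exists_le_of_integral_gt {g : ℝ → ℝ} (hg : ∀ c d, IntervalIntegrable g volume c d)
    {A L R a b : ℝ} (haL : 3 * (a - L) < R - L) (hbR : 3 * (R - b) < R - L) (hLR : L < R)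
    (hint : A * (R - L) < ∫ s in L..R, g s)
    (ha : L < a → ∀ c d, c < d → d - c ≤ 3 * (a - c) → 3 * (a - c) ≤ 2 * (d - c) →
      ∫ s in c..d, g s ≤ A * (d - c))
    (hb : b < R → ∀ c d, c < d → d - c ≤ 3 * (b - c) → 3 * (b - c) ≤ 2 * (d - c) →
      ∫ s in c..d, g s ≤ A * (d - c)) :
    ∃ s, a < s ∧ s < b ∧ A ≤ g s := by
  by_contra! hlt
  have hmid : ∀ c d, a ≤ c → c ≤ d → d ≤ b → ∫ s in c..d, g s ≤ A * (d - c) := by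
    intro c d hac hcd hdb
    calc ∫ s in c..d, g s ≤ ∫ s in c..d, A :=
          intervalIntegral.integral_mono_on_of_le_Ioo hcd (hg c d) intervalIntegrable_const
            fun s hs => (hlt s (hac.trans_lt hs.1) (hs.2.trans_le hdb)).le
      _ = A * (d - c) := by simp [mul_comm]
  have hadd : ∀ c d e, ∫ s in c..e, g s = (∫ s in c..d, g s) + ∫ s in d..e, g s := fun c d e =>
    (intervalIntegral.integral_add_adjacent_intervals (hg c d) (hg d e)).symm
  rcases le_or_gt a L with haL' | haL' <;> rcases le_or_gt R b with hbR' | hbR'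
  · linarith [hmid L R haL' hLR.le hbR']
  · have h1 := hmid L (R - 3 * (R - b)) haL' (by linarith) (by linarith)
    have h2 := hb hbR' (R - 3 * (R - b)) R (by linarith) (by linarith) (by linarith)
    have h3 := hadd L (R - 3 * (R - b)) R
    linarith
  · have h1 := hmid (L + 3 * (a - L)) R (by linarith) (by linarith) hbR'
    have h2 := ha haL' L (L + 3 * (a - L)) (by linarith) (by linarith) (by linarith)
    have h3 := hadd L (L + 3 * (a - L)) R
    linarith
  · rcases lt_or_ge (3 * (a - L) + 3 * (R - b)) (R - L) with hc | hc
    · have h0 := hmid (L + 3 * (a - L)) (R - 3 * (R - b)) (by linarith) (by linarith) (by linarith)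
      have h1 := hb hbR' (R - 3 * (R - b)) R (by linarith) (by linarith) (by linarith)
      have h2 := ha haL' L (L + 3 * (a - L)) (by linarith) (by linarith) (by linarith)
      have h3 := hadd L (L + 3 * (a - L)) R
      have h4 := hadd (L + 3 * (a - L)) (R - 3 * (R - b)) R
      linarith
    · obtain ⟨e, he1, he2, he3, he4⟩ : ∃ e, 3 * (a - L) ≤ 2 * (e - L) ∧ e - L ≤ 3 * (a - L) ∧
          3 * (R - b) ≤ 2 * (R - e) ∧ R - e ≤ 3 * (R - b) := by
        refine ⟨max (L + 3 * (a - L) / 2) (R - 3 * (R - b)), ?_, ?_, ?_, ?_⟩ <;>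
        rcases max_cases (L + 3 * (a - L) / 2) (R - 3 * (R - b)) with ⟨h, h'⟩ | ⟨h, h'⟩ <;>
        rw [h] <;> linarith
      have h1 := ha haL' L e (by linarith) (by linarith) (by linarith)
      have h2 := hb hbR' e R (by linarith) (by linarith) (by linarith)
      linarith [hadd L e R]

section Maximal

variable {f : ℝ → ℝ} {α : ℝ}

theorem BoundedVariationOn.intervalIntegrable_abs (hf : BoundedVariationOn f univ) (c d : ℝ) :
    IntervalIntegrable (fun s => |f s|) volume c d := by
  obtain ⟨p, q, hp, hq, rfl⟩ :=
    hf.locallyBoundedVariationOn.exists_monotoneOn_sub_monotoneOn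
  exact ((hp.mono (subset_univ _)).intervalIntegrable.sub
    (hq.mono (subset_univ _)).intervalIntegrable).abs

theorem BoundedVariationOn.bddAbove_avgAbs (hf : BoundedVariationOn f univ) (x : ℝ) :
    BddAbove {r : ℝ | ∃ y t : ℝ, 0 < t ∧ |x - y| ≤ α * t ∧ r = avgAbs f y t} := by
  refine ⟨|f 0| + (eVariationOn f univ).toReal, ?_⟩
  rintro r ⟨y, t, ht, -, rfl⟩
  have hC : ∀ s, |f s| ≤ |f 0| + (eVariationOn f univ).toReal := fun s => by
    have := hf.dist_le (mem_univ s) (mem_univ 0)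
    rw [Real.dist_eq] at this
    linarith [abs_sub_abs_le_abs_sub (f s) (f 0)]
  have hI : ∫ s in (y - t)..(y + t), |f s| ≤
      (|f 0| + (eVariationOn f univ).toReal) * (2 * t) := by
    calc ∫ s in (y - t)..(y + t), |f s|
        ≤ ∫ s in (y - t)..(y + t), (|f 0| + (eVariationOn f univ).toReal) :=
          intervalIntegral.integral_mono_on (by linarith) (hf.intervalIntegrable_abs _ _)
            intervalIntegrable_const fun s _ => hC s
      _ = _ := by rw [intervalIntegral.integral_const, smul_eq_mul]; ring
  rw [avgAbs, one_div, inv_mul_le_iff₀ (by positivity)]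
  linarith

theorem BoundedVariationOn.avgAbs_le_ntMax (hf : BoundedVariationOn f univ) {x y t : ℝ}
    (ht : 0 < t) (hxy : |x - y| ≤ α * t) : avgAbs f y t ≤ ntMax α f x :=
  le_csSup (hf.bddAbove_avgAbs x) ⟨y, t, ht, hxy, rfl⟩

/-- Intervals containing `x` in their middle third are admissible for `ntMax α f x` when
`1 / 3 ≤ α`. -/
theorem BoundedVariationOn.integral_abs_le_ntMax_mul (hf : BoundedVariationOn f univ)
    (hα : 1 / 3 ≤ α) {x c d : ℝ} (hcd : c < d) (h1 : d - c ≤ 3 * (x - c))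
    (h2 : 3 * (x - c) ≤ 2 * (d - c)) : ∫ s in c..d, |f s| ≤ ntMax α f x * (d - c) := by
  have h := hf.avgAbs_le_ntMax (α := α) (x := x) (y := (c + d) / 2) (t := (d - c) / 2)
    (by linarith) (by
      have : 1 / 3 * ((d - c) / 2) ≤ α * ((d - c) / 2) :=
        mul_le_mul_of_nonneg_right hα (by linarith)
      rw [abs_le]; constructor <;> linarith)
  rw [avgAbs, one_div, show (c + d) / 2 - (d - c) / 2 = c by ring,
    show (c + d) / 2 + (d - c) / 2 = d by ring, show 2 * ((d - c) / 2) = d - c by ring,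
    inv_mul_le_iff₀ (by linarith)] at h
  linarith

theorem exists_avgAbs_gt (hα : 0 ≤ α) {x A : ℝ} (hA : A < ntMax α f x) :
    ∃ y t : ℝ, 0 < t ∧ |x - y| ≤ α * t ∧ A < avgAbs f y t := by
  obtain ⟨r, ⟨y, t, ht, hxy, rfl⟩, hr⟩ := exists_lt_of_lt_csSup
    (s := {r : ℝ | ∃ y t : ℝ, 0 < t ∧ |x - y| ≤ α * t ∧ r = avgAbs f y t})
    ⟨_, x, 1, one_pos, by simpa using hα, rfl⟩ hA
  exact ⟨y, t, ht, hxy, hr⟩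

theorem BoundedVariationOn.exists_abs_ge_of_avgAbs_gt (hf : BoundedVariationOn f univ)
    (hα : 1 / 3 ≤ α) {x y t A a b : ℝ} (ht : 0 < t) (hxy : |x - y| ≤ α * t)
    (hA : A < avgAbs f y t) (ha : a ≤ y - t ∨ a < x ∧ ntMax α f a ≤ A)
    (hb : y + t ≤ b ∨ x < b ∧ ntMax α f b ≤ A) : ∃ s, a < s ∧ s < b ∧ A ≤ |f s| := by
  have hαt : 1 / 3 * t ≤ α * t := mul_le_mul_of_nonneg_right hα ht.le
  have hout : ∀ z, ntMax α f z ≤ A → α * t < |z - y| := fun z hz => by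
    by_contra! hzy
    linarith [hf.avgAbs_le_ntMax ht hzy]
  have hx := abs_le.1 hxy
  have hle : ∀ z, ntMax α f z ≤ A → ∀ c d, c < d → d - c ≤ 3 * (z - c) →
      3 * (z - c) ≤ 2 * (d - c) → ∫ s in c..d, |f s| ≤ A * (d - c) :=
    fun z hz c d hcd h1 h2 => (hf.integral_abs_le_ntMax_mul hα hcd h1 h2).trans
      (mul_le_mul_of_nonneg_right hz (by linarith))
  refine exists_le_of_integral_gt (g := fun s => |f s|) (L := y - t) (R := y + t)
    hf.intervalIntegrable_abs ?_ ?_ (by linarith) ?_ ?_ ?_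
  · rcases ha with ha | ⟨hax, ha⟩
    · linarith
    · rcases lt_abs.1 (hout a ha) with h | h <;> linarith
  · rcases hb with hb | ⟨hbx, hb⟩
    · linarith
    · rcases lt_abs.1 (hout b hb) with h | h <;> linarith
  · rw [avgAbs, one_div, lt_inv_mul_iff₀ (by positivity)] at hA
    linarith
  · exact fun h => hle a (ha.resolve_left (not_le.2 h)).2
  · exact fun h => hle b (hb.resolve_left (not_le.2 h)).2

theorem BoundedVariationOn.exists_abs_le_ntMax (hf : BoundedVariationOn f univ) (hα : 0 ≤ α)
    {x q s : ℝ} (hq : q < x) (hs : x < s) : ∃ p, q < p ∧ p < s ∧ |f p| ≤ ntMax α f x := by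
  by_contra! hlt
  set t := min (x - q) (s - x)
  have ht : 0 < t := lt_min (by linarith) (by linarith)
  have htq : t ≤ x - q := min_le_left _ _
  have hts : t ≤ s - x := min_le_right _ _
  have h := hf.avgAbs_le_ntMax (α := α) (x := x) (y := x) ht (by simpa using by positivity)
  rw [avgAbs, one_div, inv_mul_le_iff₀ (by positivity)] at h
  have hpos : 0 < ∫ p in (x - t)..(x + t), (|f p| - ntMax α f x) :=
    intervalIntegral.intervalIntegral_pos_of_pos_on
      ((hf.intervalIntegrable_abs _ _).sub intervalIntegrable_const)
      (fun p hp => sub_pos.2 (hlt p (by linarith [hp.1]) (by linarith [hp.2]))) (by linarith)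
  rw [intervalIntegral.integral_sub (hf.intervalIntegrable_abs _ _) intervalIntegrable_const,
    intervalIntegral.integral_const, smul_eq_mul] at hpos
  linarith

end Maximal

/-- For `α ≥ 1/3` and every function `f : ℝ → ℝ` of bounded variation, the variation of the
nontangential maximal function `M^α f` is at most the variation of `f`. -/
theorem variation_ntMax_le (α : ℝ) (hα : (1 / 3 : ℝ) ≤ α) (f : ℝ → ℝ)
    (hf : BoundedVariationOn f Set.univ) :
    eVariationOn (ntMax α f) Set.univ ≤ eVariationOn f Set.univ := by
  have hα0 : 0 ≤ α := by linarith
  have habs : eVariationOn (fun s => |f s|) univ ≤ eVariationOn f univ := by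
    have h := (LipschitzWith.lipschitzOnWith (s := univ)
      (lipschitzWith_one_norm (E := ℝ))).comp_eVariationOn_le (mapsTo_univ f univ)
    rw [ENNReal.coe_one, one_mul] at h
    exact h
  refine le_trans (eVariationOn_le_of_peaks (ne_top_of_le_ne_top hf habs) ?_ ?_ ?_ ?_) habs
  · exact fun x q hq s hs => hf.exists_abs_le_ntMax hα0 hq hs
  · intro a x b hax hxb ha hb ε hε
    obtain ⟨y, t, ht, hxy, hA⟩ := exists_avgAbs_gt hα0
      (max_lt (max_lt ha hb) (sub_lt_self (ntMax α f x) hε))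
    obtain ⟨s, hs1, hs2, hs3⟩ := hf.exists_abs_ge_of_avgAbs_gt hα ht hxy hA
      (Or.inr ⟨hax, (le_max_left _ _).trans (le_max_left _ _)⟩)
      (Or.inr ⟨hxb, (le_max_right _ _).trans (le_max_left _ _)⟩)
    exact ⟨s, hs1, hs2, (le_max_right _ _).trans hs3⟩
  · intro x b hxb hb ε hε
    obtain ⟨y, t, ht, hxy, hA⟩ := exists_avgAbs_gt hα0
      (max_lt hb (sub_lt_self (ntMax α f x) hε))
    obtain ⟨s, -, hs2, hs3⟩ := hf.exists_abs_ge_of_avgAbs_gt hα ht hxy hA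
      (Or.inl le_rfl) (Or.inr ⟨hxb, le_max_left _ _⟩)
    exact ⟨s, hs2, (le_max_right _ _).trans hs3⟩
  · intro a x hax ha ε hε
    obtain ⟨y, t, ht, hxy, hA⟩ := exists_avgAbs_gt hα0
      (max_lt ha (sub_lt_self (ntMax α f x) hε))
    obtain ⟨s, hs1, -, hs3⟩ := hf.exists_abs_ge_of_avgAbs_gt hα ht hxy hA
      (Or.inr ⟨hax, le_max_left _ _⟩) (Or.inl le_rfl)
    exact ⟨s, hs1, (le_max_right _ _).trans hs3⟩
end

section
/- For every α ≥ 1/3, the indicator function f = χ_{(-1,0)} satisfies V(M^α f) = V(f) = 2. In particular, the constant 1 in the inequality V(M^α f) ≤ V(f) is sharp and extremizers exist. -/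
open MeasureTheory Set Filter Topology

theorem eVariationOn_Ici_eq_one_of_antitoneOn {f : ℝ → ℝ} {c : ℝ} (hf : AntitoneOn f (Ici c))
    (hc : f c = 1) (h0 : ∀ x, 0 ≤ f x) (hlim : Tendsto f atTop (𝓝 0)) :
    eVariationOn f (Ici c) = 1 := by
  apply le_antisymm
  · refine iSup_le ?_
    rintro ⟨n, u, hu, us⟩
    have key : ∀ i, edist (f (u (i + 1))) (f (u i))
        = ENNReal.ofReal (f (u i) - f (u (i + 1))) := fun i => by
      rw [edist_comm, edist_dist, Real.dist_eq, abs_of_nonneg]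
      exact sub_nonneg.2 (hf (us i) (us (i + 1)) (hu i.le_succ))
    simp only [key]
    rw [← ENNReal.ofReal_sum_of_nonneg fun i _ =>
      sub_nonneg.2 (hf (us i) (us (i + 1)) (hu i.le_succ)), Finset.sum_range_sub',
      ← ENNReal.ofReal_one]
    apply ENNReal.ofReal_le_ofReal
    have := hf self_mem_Ici (us 0) (us 0)
    linarith [h0 (u n)]
  · have h : Tendsto (fun x => edist (f c) (f x)) atTop (𝓝 (edist (f c) 0)) :=
      tendsto_const_nhds.edist hlim
    have h1 : edist (f c) 0 = 1 := by simp [hc, edist_dist]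
    rw [← h1]
    refine le_of_tendsto h ?_
    filter_upwards [eventually_ge_atTop c] with x hx
    exact eVariationOn.edist_le f self_mem_Ici hx

theorem eVariationOn_univ_eq_two_of_symmetric {f : ℝ → ℝ} {c : ℝ} (hf : AntitoneOn f (Ici c))
    (hc : f c = 1) (h0 : ∀ x, 0 ≤ f x) (hlim : Tendsto f atTop (𝓝 0))
    (hsymm : ∀ x, f (2 * c - x) = f x) :
    eVariationOn f univ = 2 := by
  have hcomp : f ∘ (fun x => 2 * c - x) = f := funext hsymm
  have hφ : ∀ s : Set ℝ, AntitoneOn (fun x : ℝ => 2 * c - x) s := fun s x _ y _ hxy =>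
    sub_le_sub_left hxy _
  have hright := eVariationOn_Ici_eq_one_of_antitoneOn hf hc h0 hlim
  have hleft : eVariationOn f (Iic c) = 1 := by
    have h := eVariationOn.comp_eq_of_antitoneOn f (fun x => 2 * c - x) (hφ (Iic c))
    rw [hcomp, image_const_sub_Iic, two_mul, add_sub_cancel_right, hright] at h
    exact h
  rw [← Iic_union_Ici (a := c), eVariationOn.union f isGreatest_Iic isLeast_Ici, hleft, hright]
  norm_num

theorem avgAbs_indicator_Ioo {t : ℝ} (y : ℝ) (ht : 0 < t) :
    avgAbs (indicator (Ioo (-1 : ℝ) 0) (fun _ => (1 : ℝ))) y t =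
      max (min (y + t) 0 - max (y - t) (-1)) 0 / (2 * t) := by
  have habs : (fun s => |indicator (Ioo (-1 : ℝ) 0) (fun _ => (1 : ℝ)) s|) =
      indicator (Ioo (-1 : ℝ) 0) (fun _ => (1 : ℝ)) := by
    ext s
    exact abs_of_nonneg (indicator_nonneg (fun _ _ => zero_le_one) s)
  rw [avgAbs, habs, intervalIntegral.integral_of_le (by linarith), integral_Ioc_eq_integral_Ioo,
    setIntegral_indicator measurableSet_Ioo, Ioo_inter_Ioo, setIntegral_const, Real.volume_real_Ioo]
  simp only [smul_eq_mul, mul_one]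
  ring

theorem avgAbs_indicator_Ioo_nonneg {t : ℝ} (y : ℝ) (ht : 0 < t) :
    0 ≤ avgAbs (indicator (Ioo (-1 : ℝ) 0) (fun _ => (1 : ℝ))) y t := by
  rw [avgAbs_indicator_Ioo y ht]
  positivity

theorem avgAbs_indicator_Ioo_le_one {t : ℝ} (y : ℝ) (ht : 0 < t) :
    avgAbs (indicator (Ioo (-1 : ℝ) 0) (fun _ => (1 : ℝ))) y t ≤ 1 := by
  rw [avgAbs_indicator_Ioo y ht, div_le_one (by positivity)]
  grind

theorem bddAbove_avgAbs_indicator_Ioo (α x : ℝ) :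
    BddAbove {r : ℝ | ∃ y t : ℝ, 0 < t ∧ |x - y| ≤ α * t ∧
      r = avgAbs (indicator (Ioo (-1 : ℝ) 0) (fun _ => (1 : ℝ))) y t} := by
  refine ⟨1, ?_⟩
  rintro r ⟨y, t, ht, -, rfl⟩
  exact avgAbs_indicator_Ioo_le_one y ht

theorem ntMax_indicator_Ioo_nonneg (α x : ℝ) :
    0 ≤ ntMax α (indicator (Ioo (-1 : ℝ) 0) (fun _ => (1 : ℝ))) x := by
  apply Real.sSup_nonneg
  rintro r ⟨y, t, ht, -, rfl⟩
  exact avgAbs_indicator_Ioo_nonneg y ht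

theorem ntMax_indicator_Ioo_le_one (α x : ℝ) :
    ntMax α (indicator (Ioo (-1 : ℝ) 0) (fun _ => (1 : ℝ))) x ≤ 1 := by
  refine Real.sSup_le ?_ zero_le_one
  rintro r ⟨y, t, ht, -, rfl⟩
  exact avgAbs_indicator_Ioo_le_one y ht

theorem avgAbs_le_ntMax_indicator_Ioo {α x y t : ℝ} (ht : 0 < t) (h : |x - y| ≤ α * t) :
    avgAbs (indicator (Ioo (-1 : ℝ) 0) (fun _ => (1 : ℝ))) y t ≤
      ntMax α (indicator (Ioo (-1 : ℝ) 0) (fun _ => (1 : ℝ))) x :=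
  le_csSup (bddAbove_avgAbs_indicator_Ioo α x) ⟨y, t, ht, h, rfl⟩

theorem ntMax_indicator_Ioo_eq_one {α x : ℝ} (hα : 0 ≤ α) (hx : x ∈ Ioo (-1 : ℝ) 0) :
    ntMax α (indicator (Ioo (-1 : ℝ) 0) (fun _ => (1 : ℝ))) x = 1 := by
  refine le_antisymm (ntMax_indicator_Ioo_le_one α x) ?_
  obtain ⟨hx1, hx2⟩ := hx
  have ht : 0 < min (x + 1) (-x) := lt_min (by linarith) (by linarith)
  have h1 := min_le_left (x + 1) (-x)
  have h2 := min_le_right (x + 1) (-x)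
  generalize min (x + 1) (-x) = t at ht h1 h2
  have h := avgAbs_le_ntMax_indicator_Ioo (α := α) (x := x) (y := x) ht
    (by simpa using mul_nonneg hα ht.le)
  rwa [avgAbs_indicator_Ioo x ht, min_eq_left (by linarith), max_eq_left (b := -1) (by linarith),
    max_eq_left (by linarith), show x + t - (x - t) = 2 * t by ring, div_self (by positivity)] at h

theorem ntMax_indicator_Ioo_le_reflect (α x : ℝ) :
    ntMax α (indicator (Ioo (-1 : ℝ) 0) (fun _ => (1 : ℝ))) x ≤
      ntMax α (indicator (Ioo (-1 : ℝ) 0) (fun _ => (1 : ℝ))) (-1 - x) := by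
  refine Real.sSup_le ?_ (ntMax_indicator_Ioo_nonneg _ _)
  rintro r ⟨y, t, ht, h, rfl⟩
  have h' : |(-1 - x) - (-1 - y)| ≤ α * t := by
    rwa [sub_sub_sub_cancel_left, abs_sub_comm]
  refine le_of_eq_of_le ?_ (avgAbs_le_ntMax_indicator_Ioo ht h')
  rw [avgAbs_indicator_Ioo _ ht, avgAbs_indicator_Ioo _ ht]
  congr 1
  grind

theorem antitoneOn_ntMax_indicator_Ioo {α : ℝ} (hα : 0 ≤ α) :
    AntitoneOn (ntMax α (indicator (Ioo (-1 : ℝ) 0) (fun _ => (1 : ℝ)))) (Ici (-1 / 2)) := by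
  intro x hx x' _ hxx'
  rw [mem_Ici] at hx
  rcases lt_or_ge x 0 with hx0 | hx0
  · rw [ntMax_indicator_Ioo_eq_one hα ⟨by linarith, hx0⟩]
    exact ntMax_indicator_Ioo_le_one α x'
  refine Real.sSup_le ?_ (ntMax_indicator_Ioo_nonneg _ _)
  rintro r ⟨y, t, ht, h, rfl⟩
  have hαt : 0 ≤ α * t := mul_nonneg hα ht.le
  rcases le_or_gt |x - y| (α * t) with h' | h'
  · exact avgAbs_le_ntMax_indicator_Ioo ht h'
  have hy : x + α * t ≤ y := by
    rw [abs_le] at h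
    rcases lt_abs.1 h' with h' | h' <;> linarith
  refine le_trans ?_ (avgAbs_le_ntMax_indicator_Ioo (y := x + α * t) ht
    (by rw [sub_add_cancel_left, abs_neg, abs_of_nonneg hαt]))
  rw [avgAbs_indicator_Ioo _ ht, avgAbs_indicator_Ioo _ ht]
  gcongr ?_ / _
  rw [min_eq_right (by linarith), min_eq_right (by linarith)]
  gcongr

theorem tendsto_ntMax_indicator_Ioo_atTop {α : ℝ} (hα : 0 ≤ α) :
    Tendsto (ntMax α (indicator (Ioo (-1 : ℝ) 0) (fun _ => (1 : ℝ)))) atTop (𝓝 0) := by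
  refine squeeze_zero' (g := fun x => (1 + α) / (2 * x))
    (Eventually.of_forall (ntMax_indicator_Ioo_nonneg α)) ?_
    (tendsto_const_nhds.div_atTop (tendsto_id.const_mul_atTop two_pos))
  filter_upwards [eventually_gt_atTop 0] with x hx
  refine Real.sSup_le ?_ (by positivity)
  rintro r ⟨y, t, ht, h, rfl⟩
  rw [avgAbs_indicator_Ioo y ht]
  rcases le_or_gt 0 (y - t) with hyt | hyt
  · rw [max_eq_right]
    · rw [zero_div]
      positivity
    · grind
  · rw [div_le_div_iff₀ (by positivity) (by positivity)]
    have hL : max (min (y + t) 0 - max (y - t) (-1)) 0 ≤ 1 := by grind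
    have hxt : x ≤ (1 + α) * t := by linarith [(abs_le.1 h).2]
    nlinarith

/-- For every `α ≥ 1/3`, the indicator function `f = χ_{(-1,0)}` satisfies
`V(M^α f) = V(f) = 2`, so the constant `1` in `V(M^α f) ≤ V(f)` is sharp and
extremizers exist. -/
theorem variation_ntMax_indicator_eq_two (α : ℝ) (hα : (1 / 3 : ℝ) ≤ α) :
    eVariationOn (ntMax α (Set.indicator (Set.Ioo (-1 : ℝ) 0) (fun _ => (1 : ℝ)))) Set.univ = 2 ∧
    eVariationOn (Set.indicator (Set.Ioo (-1 : ℝ) 0) (fun _ => (1 : ℝ))) Set.univ = 2 := by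
  have hα0 : 0 ≤ α := by linarith
  constructor
  · refine eVariationOn_univ_eq_two_of_symmetric (c := -1 / 2)
      (antitoneOn_ntMax_indicator_Ioo hα0)
      (ntMax_indicator_Ioo_eq_one hα0 ⟨by norm_num, by norm_num⟩)
      (ntMax_indicator_Ioo_nonneg α) (tendsto_ntMax_indicator_Ioo_atTop hα0) fun x => ?_
    rw [show 2 * (-1 / 2) - x = -1 - x by ring]
    refine le_antisymm ?_ (ntMax_indicator_Ioo_le_reflect α x)
    simpa using ntMax_indicator_Ioo_le_reflect α (-1 - x)
  · refine eVariationOn_univ_eq_two_of_symmetric (c := -1 / 2) ?_ ?_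
      (indicator_nonneg fun _ _ => zero_le_one) ?_ ?_
    · intro x hx x' _ hxx'
      simp only [indicator_apply, mem_Ioo, mem_Ici] at *
      grind
    · norm_num [indicator_apply]
    · refine tendsto_const_nhds.congr' ?_
      filter_upwards [eventually_ge_atTop 0] with x hx
      exact (indicator_of_notMem (fun h => hx.not_gt h.2) _).symm
    · intro x
      simp only [indicator_apply, mem_Ioo]
      grind
end

section
/- Let α > 1/3 and let f : ℝ → ℝ be nonnegative, of bounded variation, and have the NORM(α) normalization. If V(M^α f) = V(f), then the limits of f at -∞ and +∞ exist and are equal, and there exists x_0 ∈ ℝ such that f is non-decreasing on (-∞, x_0) and non-increasing on (x_0, +∞). -/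
open MeasureTheory Set Filter Topology

/-- `N_α f (x) = ((1+α) limsup_{y → x} f(y) + (1-α) liminf_{y → x} f(y)) / 2`. -/
noncomputable def normAlphaFn (α : ℝ) (f : ℝ → ℝ) (x : ℝ) : ℝ :=
  ((1 + α) * Filter.limsup f (𝓝[≠] x) + (1 - α) * Filter.liminf f (𝓝[≠] x)) / 2

/-- `f` has the NORM(α) normalization: `f(x) = N_α f(x)` wherever
`M^α f(x) > limsup_{y → x} f(y)`, and `f(x) = M^α f(x)` wherever
`limsup_{y → x} f(y) ≥ M^α f(x) ≥ N_α f(x)`. -/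
def HasNormAlpha (α : ℝ) (f : ℝ → ℝ) : Prop :=
  ∀ x : ℝ,
    (Filter.limsup f (𝓝[≠] x) < ntMax α f x → f x = normAlphaFn α f x) ∧
    (ntMax α f x ≤ Filter.limsup f (𝓝[≠] x) ∧ normAlphaFn α f x ≤ ntMax α f x →
      f x = ntMax α f x)

theorem eVariationOn_le_ofReal_of_abs_sub_le {h Φ : ℝ → ℝ} {s : Set ℝ} {b c : ℝ}
    (hs : s ⊆ Icc b c) (hb : b ∈ s) (hc : c ∈ s)
    (H : ∀ x ∈ s, ∀ y ∈ s, x ≤ y → |h y - h x| ≤ Φ y - Φ x) :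
    eVariationOn h s ≤ ENNReal.ofReal (Φ c - Φ b) := by
  refine iSup_le fun ⟨n, u, hu, us⟩ => ?_
  have hsum : ∀ i, edist (h (u (i + 1))) (h (u i)) ≤
      ENNReal.ofReal (Φ (u (i + 1)) - Φ (u i)) := fun i => by
    rw [edist_dist, Real.dist_eq]
    exact ENNReal.ofReal_le_ofReal (H _ (us i) _ (us (i + 1)) (hu (Nat.le_succ i)))
  refine (Finset.sum_le_sum fun i _ => hsum i).trans ?_
  have hnn : ∀ x ∈ s, ∀ y ∈ s, x ≤ y → Φ x ≤ Φ y := fun x hx y hy hxy => by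
    linarith [H x hx y hy hxy, abs_nonneg (h y - h x)]
  rw [← ENNReal.ofReal_sum_of_nonneg
    fun i _ => sub_nonneg.2 (hnn _ (us i) _ (us (i + 1)) (hu (Nat.le_succ i))),
    Finset.sum_range_sub (fun i => Φ (u i))]
  refine ENNReal.ofReal_le_ofReal ?_
  linarith [hnn _ (us n) _ hc (hs (us n)).2, hnn _ hb _ (us 0) (hs (us 0)).1]

theorem abs_sub_eq_abs_max_sub_add_abs_min_sub (p q l : ℝ) :
    |p - q| = |max p l - max q l| + |min p l - min q l| := by
  rcases le_total p l with h1 | h1 <;> rcases le_total q l with h2 | h2 <;>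
    simp only [max_eq_left, max_eq_right, min_eq_left, min_eq_right, h1, h2, sub_self, abs_zero,
      zero_add, add_zero]
  · rw [abs_of_nonpos (by linarith), abs_of_nonpos (by linarith), abs_of_nonpos (by linarith)]
    ring
  · rw [abs_of_nonneg (by linarith), abs_of_nonneg (by linarith), abs_of_nonneg (by linarith)]
    ring

theorem eVariationOn_max_const_le (f : ℝ → ℝ) (l : ℝ) (s : Set ℝ) :
    eVariationOn (fun x => max (f x) l) s ≤ eVariationOn f s := by
  refine iSup_le fun ⟨n, u, hu, us⟩ => (Finset.sum_le_sum fun i _ => ?_).trans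
    (eVariationOn.sum_le hu us)
  rw [edist_dist, edist_dist, Real.dist_eq, Real.dist_eq]
  refine ENNReal.ofReal_le_ofReal ?_
  rw [abs_sub_eq_abs_max_sub_add_abs_min_sub (f (u (i + 1))) (f (u i)) l]
  linarith [abs_nonneg (min (f (u (i + 1))) l - min (f (u i)) l)]

theorem eVariationOn_max_const_lt_of_endpoints {f : ℝ → ℝ} {l : ℝ} {s : Set ℝ} {p q : ℝ}
    (hf : BoundedVariationOn f s) (hs : s ⊆ Icc p q) (hp : p ∈ s) (hq : q ∈ s)
    (hpq : min (f p) l ≠ min (f q) l) :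
    eVariationOn (fun x => max (f x) l) s < eVariationOn f s := by
  have hloc := hf.locallyBoundedVariationOn
  have hv : ∀ x ∈ s, ∀ y ∈ s, x ≤ y →
      |f y - f x| ≤ variationOnFromTo f s p y - variationOnFromTo f s p x :=
    fun x hx y hy hxy => by
      exact variationOnFromTo.abs_sub_le_sub_of_le hloc hp hx hy hxy
  have hle : p ≤ q := (hs hp).2
  have hend : variationOnFromTo f s p q = (eVariationOn f s).toReal := by
    rw [variationOnFromTo.eq_of_le f s hle, inter_eq_left.2 hs]
  have hstart : variationOnFromTo f s p p = 0 := variationOnFromTo.self f s p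
  have hend' : |f q - f p| ≤ (eVariationOn f s).toReal := by
    have := hv p hp q hq hle
    rwa [hend, hstart, sub_zero] at this
  have hsplit := fun x y => abs_sub_eq_abs_max_sub_add_abs_min_sub (f y) (f x) l
  have hminus := eVariationOn_le_ofReal_of_abs_sub_le (h := fun x => max (f x) l)
    (Φ := fun x => variationOnFromTo f s p x - min (f x) l) hs hp hq fun x hx y hy hxy => by
      linarith [hv x hx y hy hxy, hsplit x y, le_abs_self (min (f y) l - min (f x) l)]
  have hplus := eVariationOn_le_ofReal_of_abs_sub_le (h := fun x => max (f x) l)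
    (Φ := fun x => variationOnFromTo f s p x + min (f x) l) hs hp hq fun x hx y hy hxy => by
      linarith [hv x hx y hy hxy, hsplit x y, neg_abs_le (min (f y) l - min (f x) l)]
  have hpos : 0 < (eVariationOn f s).toReal := by
    have : 0 < |min (f q) l - min (f p) l| := abs_pos.2 (sub_ne_zero.2 hpq.symm)
    linarith [hsplit p q, abs_nonneg (max (f q) l - max (f p) l)]
  rw [← ENNReal.ofReal_toReal (show eVariationOn f s ≠ ⊤ from hf)]
  simp only [hend, hstart] at hminus hplus
  rcases lt_or_gt_of_ne hpq with h | h
  · exact hminus.trans_lt ((ENNReal.ofReal_lt_ofReal_iff hpos).2 (by linarith))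
  · exact hplus.trans_lt ((ENNReal.ofReal_lt_ofReal_iff hpos).2 (by linarith))

theorem eVariationOn_eq_add_add (f : ℝ → ℝ) {s : Set ℝ} {p q : ℝ} (hp : p ∈ s) (hq : q ∈ s)
    (hpq : p ≤ q) :
    eVariationOn f s =
      eVariationOn f (s ∩ Iic p) + eVariationOn f (s ∩ Icc p q) + eVariationOn f (s ∩ Ici q) := by
  rw [← eVariationOn.union f (x := p), ← eVariationOn.union f (x := q)]
  · congr 1
    ext x
    simp only [mem_union, mem_inter_iff, mem_Iic, mem_Icc, mem_Ici]
    constructor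
    · intro hx
      rcases le_total x p with h1 | h1
      · exact Or.inl (Or.inl ⟨hx, h1⟩)
      · rcases le_total x q with h2 | h2
        · exact Or.inl (Or.inr ⟨hx, h1, h2⟩)
        · exact Or.inr ⟨hx, h2⟩
    · tauto
  · refine ⟨Or.inr ⟨hq, hpq, le_rfl⟩, ?_⟩
    rintro x (hx | hx)
    · exact hx.2.trans hpq
    · exact hx.2.2
  · exact ⟨⟨hq, le_refl q⟩, fun x hx => hx.2⟩
  · exact ⟨⟨hp, le_refl p⟩, fun x hx => hx.2⟩
  · exact ⟨⟨hp, le_rfl, hpq⟩, fun x hx => hx.2.1⟩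

theorem ENNReal.add_add_lt_add_add {a b c a' b' c' : ENNReal} (ha : a ≤ a') (hb : b < b')
    (hc : c ≤ c') (ha' : a' ≠ ⊤) (hc' : c' ≠ ⊤) : a + b + c < a' + b' + c' :=
  ENNReal.add_lt_add_of_lt_of_le (ne_top_of_le_ne_top hc' hc)
    (ENNReal.add_lt_add_of_le_of_lt (ne_top_of_le_ne_top ha' ha) ha hb) hc

theorem eVariationOn_max_const_lt {f : ℝ → ℝ} {l : ℝ} {s : Set ℝ} {b c : ℝ}
    (hf : BoundedVariationOn f s) (hb : b ∈ s) (hc : c ∈ s) (hbl : f b < l) (hcl : l ≤ f c) :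
    eVariationOn (fun x => max (f x) l) s < eVariationOn f s := by
  have key : ∀ p ∈ s, ∀ q ∈ s, p ≤ q → min (f p) l ≠ min (f q) l →
      eVariationOn (fun x => max (f x) l) s < eVariationOn f s := by
    intro p hp q hq hpq hne
    rw [eVariationOn_eq_add_add _ hp hq hpq, eVariationOn_eq_add_add f hp hq hpq]
    exact ENNReal.add_add_lt_add_add (eVariationOn_max_const_le f l _)
      (eVariationOn_max_const_lt_of_endpoints (hf.mono inter_subset_left) inter_subset_right
        ⟨hp, le_rfl, hpq⟩ ⟨hq, hpq, le_rfl⟩ hne)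
      (eVariationOn_max_const_le f l _) (hf.mono inter_subset_left) (hf.mono inter_subset_left)
  have hne : min (f b) l ≠ min (f c) l := by
    rw [min_eq_left hbl.le, min_eq_right hcl]
    exact hbl.ne
  rcases le_total b c with h | h
  · exact key b hb c hc h hne
  · exact key c hc b hb h hne.symm

open Classical in
theorem eVariationOn_piecewise_max_const_lt {f : ℝ → ℝ} {l p q b : ℝ}
    (hf : BoundedVariationOn f univ) (hb : b ∈ Icc p q) (hbl : f b < l) (hpl : l ≤ f p)
    (hql : l ≤ f q) :
    eVariationOn ((Icc p q).piecewise (fun x => max (f x) l) f) univ < eVariationOn f univ := by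
  have hpq : p ≤ q := hb.1.trans hb.2
  rw [eVariationOn_eq_add_add _ (mem_univ p) (mem_univ q) hpq,
    eVariationOn_eq_add_add f (mem_univ p) (mem_univ q) hpq]
  simp only [univ_inter]
  have hp : EqOn ((Icc p q).piecewise (fun x => max (f x) l) f) f (Iic p) := fun x hx => by
    by_cases h : x ∈ Icc p q
    · rw [piecewise_eq_of_mem _ _ _ h, le_antisymm hx h.1]
      exact max_eq_left hpl
    · exact piecewise_eq_of_notMem _ _ _ h
  have hq : EqOn ((Icc p q).piecewise (fun x => max (f x) l) f) f (Ici q) := fun x hx => by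
    by_cases h : x ∈ Icc p q
    · rw [piecewise_eq_of_mem _ _ _ h, le_antisymm h.2 hx]
      exact max_eq_left hql
    · exact piecewise_eq_of_notMem _ _ _ h
  refine ENNReal.add_add_lt_add_add (eVariationOn.congr hp).le ?_ (eVariationOn.congr hq).le
    (hf.mono (subset_univ _)) (hf.mono (subset_univ _))
  rw [eVariationOn.congr (piecewise_eqOn (Icc p q) (fun x => max (f x) l) f)]
  exact eVariationOn_max_const_lt (hf.mono (subset_univ _)) hb (left_mem_Icc.2 hpq) hbl hpl

theorem eVariationOn_neg (f : ℝ → ℝ) (s : Set ℝ) :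
    eVariationOn (fun x => -f x) s = eVariationOn f s := by
  simp only [eVariationOn, edist_neg_neg]

open Classical in
theorem eVariationOn_piecewise_min_const_lt {f : ℝ → ℝ} {l p q b : ℝ}
    (hf : BoundedVariationOn f univ) (hb : b ∈ Icc p q) (hbl : l < f b) (hpl : f p ≤ l)
    (hql : f q ≤ l) :
    eVariationOn ((Icc p q).piecewise (fun x => min (f x) l) f) univ < eVariationOn f univ := by
  have hneg : BoundedVariationOn (fun x => -f x) univ := by
    rw [BoundedVariationOn, eVariationOn_neg]
    exact hf
  have h := eVariationOn_piecewise_max_const_lt hneg hb (neg_lt_neg hbl) (neg_le_neg hpl)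
    (neg_le_neg hql)
  rw [eVariationOn_neg, ← eVariationOn_neg] at h
  convert h using 2
  ext x
  by_cases hx : x ∈ Icc p q
  · simp [piecewise, hx, ← neg_inf]
  · simp [piecewise, hx]

/-- If `g` comes arbitrarily close to lying below `M` near every point, and on every interval at
whose ends `M` is below `M x` it nearly reaches the value `M x`, then the variation of `M` is at
most that of `g`. -/
theorem eVariationOn_le_of_attained_maxima {M g : ℝ → ℝ} (hg : BoundedVariationOn g univ)
    (hlow : ∀ x ε δ : ℝ, 0 < ε → 0 < δ → ∃ w, |w - x| < δ ∧ g w ≤ M x + ε)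
    (hmid : ∀ a x b ε : ℝ, a < x → x < b → M a < M x → M b < M x → 0 < ε →
      ∃ z, a < z ∧ z < b ∧ M x - ε ≤ g z)
    (hleft : ∀ x b ε : ℝ, x < b → M b < M x → 0 < ε → ∃ z, z < b ∧ M x - ε ≤ g z)
    (hright : ∀ a x ε : ℝ, a < x → M a < M x → 0 < ε → ∃ z, a < z ∧ M x - ε ≤ g z) :
    eVariationOn M univ ≤ eVariationOn g univ := by
  obtain ⟨v, hv0, hvV, hv⟩ : ∃ v : ℝ → ℝ, (∀ x, 0 ≤ v x) ∧
      (∀ x, v x ≤ (eVariationOn g univ).toReal) ∧ ∀ x y, x ≤ y → |g y - g x| ≤ v y - v x := by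
    refine ⟨fun x => (eVariationOn g (Iic x)).toReal, fun x => ENNReal.toReal_nonneg,
      fun x => ENNReal.toReal_mono hg (eVariationOn.mono _ (subset_univ _)), fun x y hxy => ?_⟩
    have h1 : eVariationOn g (Iic x) + eVariationOn g (Icc x y) = eVariationOn g (Iic y) := by
      rw [← eVariationOn.union g (x := x) isGreatest_Iic (isLeast_Icc hxy),
        Iic_union_Icc_eq_Iic hxy]
    have hfx := hg.mono (subset_univ (Iic x))
    have hfxy := hg.mono (subset_univ (Icc x y))
    show _ ≤ (eVariationOn g (Iic y)).toReal - (eVariationOn g (Iic x)).toReal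
    rw [← h1, ENNReal.toReal_add hfx hfxy, add_sub_cancel_left, ← Real.dist_eq]
    exact hfxy.dist_le (right_mem_Icc.2 hxy) (left_mem_Icc.2 hxy)
  refine iSup_le fun ⟨n, u, hu, _⟩ => ?_
  simp only
  set S : ℕ → ℝ := fun k => ∑ i ∈ Finset.range k, |M (u (i + 1)) - M (u i)| with hS
  have hS1 : ∀ k, S (k + 1) = S k + |M (u (k + 1)) - M (u k)| := fun k =>
    Finset.sum_range_succ _ _
  have state : ∀ k, S k = 0 ∨
      (∃ a, a < u k ∧ M a < M (u k) ∧ ∀ ε δ : ℝ, 0 < ε → 0 < δ →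
        ∃ w, |w - a| < δ ∧ S k - M (u k) ≤ v w - g w + ε) ∨
      (∀ ε : ℝ, 0 < ε → ∃ z, z < u k ∧ S k + M (u k) ≤ v z + g z + ε) := by
    intro k
    induction k with
    | zero => exact Or.inl (by simp [hS])
    | succ k ih =>
      have hle : u k ≤ u (k + 1) := hu (Nat.le_succ k)
      rcases lt_trichotomy (M (u k)) (M (u (k + 1))) with hlt | heq | hgt
      · have hab := abs_of_pos (sub_pos.2 hlt)
        have hne : u k < u (k + 1) := lt_of_le_of_ne hle fun h => by rw [h] at hlt; exact hlt.false
        right; left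
        rcases ih with h0 | ⟨a, hau, haM, hw⟩ | hz
        · refine ⟨u k, hne, hlt, fun ε δ hε hδ => ?_⟩
          obtain ⟨w, hw1, hw2⟩ := hlow (u k) ε δ hε hδ
          exact ⟨w, hw1, by rw [hS1, hab, h0]; linarith [hv0 w]⟩
        · refine ⟨a, hau.trans_le hle, haM.trans hlt, fun ε δ hε hδ => ?_⟩
          obtain ⟨w, hw1, hw2⟩ := hw ε δ hε hδ
          exact ⟨w, hw1, by rw [hS1, hab]; linarith⟩
        · refine ⟨u k, hne, hlt, fun ε δ hε hδ => ?_⟩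
          obtain ⟨z, hz1, hz2⟩ := hz (ε / 3) (by linarith)
          obtain ⟨w, hw1, hw2⟩ := hlow (u k) (ε / 3) (min δ (u k - z)) (by linarith)
            (lt_min hδ (by linarith))
          have hzw : z ≤ w := by
            have := (abs_lt.1 (hw1.trans_le (min_le_right _ _))).1
            linarith
          refine ⟨w, hw1.trans_le (min_le_left _ _), ?_⟩
          rw [hS1, hab]
          linarith [hv z w hzw, neg_abs_le (g w - g z)]
      · have hab : |M (u (k + 1)) - M (u k)| = 0 := by rw [heq]; simp
        rw [hS1, hab, add_zero, ← heq]
        refine ih.imp id (Or.imp ?_ ?_)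
        · exact fun ⟨a, hau, h⟩ => ⟨a, hau.trans_le hle, h⟩
        · exact fun h ε hε => (h ε hε).imp fun z hz => ⟨hz.1.trans_le hle, hz.2⟩
      · have hab := abs_of_neg (sub_neg.2 hgt)
        have hne : u k < u (k + 1) := lt_of_le_of_ne hle fun h => by rw [h] at hgt; exact hgt.false
        right; right
        intro ε hε
        rw [hS1, hab]
        rcases ih with h0 | ⟨a, hau, haM, hw⟩ | hz
        · obtain ⟨z, hz1, hz2⟩ := hleft _ _ ε hne hgt hε
          exact ⟨z, hz1, by rw [h0]; linarith [hv0 z]⟩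
        · obtain ⟨z, hz1, hz2, hz3⟩ := hmid a (u k) (u (k + 1)) (ε / 3) hau hne haM hgt
            (by linarith)
          obtain ⟨w, hw1, hw2⟩ := hw (ε / 3) (z - a) (by linarith) (by linarith)
          have hwz : w ≤ z := by linarith [(abs_lt.1 hw1).2]
          refine ⟨z, hz2, ?_⟩
          linarith [hv w z hwz, le_abs_self (g z - g w)]
        · obtain ⟨z, hz1, hz2⟩ := hz ε hε
          exact ⟨z, hz1.trans hne, by linarith⟩
  have hfin : S n ≤ (eVariationOn g univ).toReal := by
    refine le_of_forall_pos_le_add fun ε hε => ?_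
    rcases state n with h0 | ⟨a, hau, haM, hw⟩ | hz
    · rw [h0]
      linarith [hv0 0, hvV 0]
    · obtain ⟨z, hz1, hz2⟩ := hright a (u n) (ε / 2) hau haM (by linarith)
      obtain ⟨w, hw1, hw2⟩ := hw (ε / 2) (z - a) (by linarith) (by linarith)
      have hwz : w ≤ z := by linarith [(abs_lt.1 hw1).2]
      linarith [hv w z hwz, neg_abs_le (g z - g w), le_abs_self (g z - g w), hvV z]
    · obtain ⟨z, hz1, hz2⟩ := hz (ε / 2) (by linarith)
      obtain ⟨w, hw1, hw2⟩ := hlow (u n) (ε / 2) (u n - z) (by linarith) (by linarith)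
      have hzw : z ≤ w := by linarith [(abs_lt.1 hw1).1]
      linarith [hv z w hzw, neg_abs_le (g w - g z), le_abs_self (g w - g z), hvV w]
  calc ∑ i ∈ Finset.range n, edist (M (u (i + 1))) (M (u i))
      = ENNReal.ofReal (S n) := by
        rw [hS, ENNReal.ofReal_sum_of_nonneg fun i _ => abs_nonneg _]
        simp only [edist_dist, Real.dist_eq]
    _ ≤ eVariationOn g univ := ENNReal.ofReal_le_of_le_toReal hfin

theorem intervalIntegral_le_of_ae_le {f : ℝ → ℝ} (hf : ∀ a b, IntervalIntegrable f volume a b)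
    {p q B : ℝ} (hpq : p ≤ q) (h : ∀ᵐ s, p < s → s < q → f s ≤ B) :
    ∫ s in p..q, f s ≤ B * (q - p) := by
  have hconst : ∫ _ in p..q, B = B * (q - p) := by
    rw [intervalIntegral.integral_const, smul_eq_mul, mul_comm]
  rw [← hconst]
  refine intervalIntegral.integral_mono_ae_restrict hpq (hf p q) intervalIntegrable_const ?_
  rw [Measure.restrict_congr_set Ioo_ae_eq_Icc.symm, EventuallyLE,
    ae_restrict_iff' measurableSet_Ioo]
  filter_upwards [h] with s hs hmem using hs hmem.1 hmem.2

theorem le_intervalIntegral_of_le {f : ℝ → ℝ} (hf : ∀ a b, IntervalIntegrable f volume a b)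
    {p q B : ℝ} (hpq : p ≤ q) (h : ∀ s, p < s → s < q → B ≤ f s) :
    B * (q - p) ≤ ∫ s in p..q, f s := by
  have hconst : ∫ _ in p..q, B = B * (q - p) := by
    rw [intervalIntegral.integral_const, smul_eq_mul, mul_comm]
  rw [← hconst]
  exact intervalIntegral.integral_mono_on_of_le_Ioo hpq intervalIntegrable_const (hf p q)
    fun s hs => h s hs.1 hs.2

section

variable {α : ℝ} {f M : ℝ → ℝ}

theorem integral_left_half_lt (hα : 1 / 3 < α) (hf : ∀ a b, IntervalIntegrable f volume a b)
    (hle : ∀ x y t : ℝ, 0 < t → |x - y| ≤ α * t → ∫ s in (y - t)..(y + t), f s ≤ M x * (2 * t))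
    {x y t A B : ℝ} (ht : 0 < t) (hxy : |x - y| ≤ α * t) (hBA : B < A)
    (hA : A * (2 * t) ≤ ∫ s in (y - t)..(y + t), f s)
    (hB : (∀ᵐ s, s < y → f s ≤ B) ∨ ∃ a, a < x ∧ M a < A ∧ ∀ᵐ s, a < s → s < y → f s ≤ B) :
    ∫ s in (y - t)..y, f s < A * t := by
  by_contra! hcon
  have hbound : (∀ᵐ s, y - t < s → s < y → f s ≤ B) → False := fun h => by
    have := intervalIntegral_le_of_ae_le hf (by linarith : y - t ≤ y) h
    nlinarith
  rcases hB with hB | ⟨a, hax, haM, hB⟩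
  · exact hbound (hB.mono fun s hs _ => hs)
  have hay : a < y - α * t := by
    by_contra! h
    have h1 := hle a y t ht (abs_le.2 ⟨by linarith, by linarith [(abs_le.1 hxy).2]⟩)
    nlinarith
  rcases le_or_gt a (y - t) with hap | hap
  · exact hbound (hB.mono fun s hs h => hs (hap.trans_lt h))
  have hαt : 0 < α * t := mul_pos (by linarith) ht
  rcases le_or_gt a (y - t / 2) with hmid | hmid
  · have h1 := hle a a (a - (y - t)) (by linarith)
      (by rw [sub_self, abs_zero]; exact mul_nonneg (by linarith) (by linarith))
    have h2 := intervalIntegral_le_of_ae_le hf (p := a + (a - (y - t))) (q := y) (B := A)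
      (by linarith) (hB.mono fun s hs h3 h4 => (hs (by linarith) h4).trans hBA.le)
    have h3 := intervalIntegral.integral_add_adjacent_intervals (hf (y - t) (a + (a - (y - t))))
      (hf (a + (a - (y - t))) y)
    rw [show a - (a - (y - t)) = y - t by ring] at h1
    nlinarith
  · have h1 := hle a (y - t / 2) (t / 2) (by linarith)
      (abs_le.2 ⟨by linarith, by nlinarith⟩)
    rw [show y - t / 2 - t / 2 = y - t by ring, show y - t / 2 + t / 2 = y by ring] at h1
    nlinarith

theorem integral_right_half_lt (hα : 1 / 3 < α) (hf : ∀ a b, IntervalIntegrable f volume a b)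
    (hle : ∀ x y t : ℝ, 0 < t → |x - y| ≤ α * t → ∫ s in (y - t)..(y + t), f s ≤ M x * (2 * t))
    {x y t A B : ℝ} (ht : 0 < t) (hxy : |x - y| ≤ α * t) (hBA : B < A)
    (hA : A * (2 * t) ≤ ∫ s in (y - t)..(y + t), f s)
    (hB : (∀ᵐ s, y < s → f s ≤ B) ∨ ∃ b, x < b ∧ M b < A ∧ ∀ᵐ s, y < s → s < b → f s ≤ B) :
    ∫ s in y..(y + t), f s < A * t := by
  by_contra! hcon
  have hbound : (∀ᵐ s, y < s → s < y + t → f s ≤ B) → False := fun h => by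
    have := intervalIntegral_le_of_ae_le hf (by linarith : y ≤ y + t) h
    nlinarith
  rcases hB with hB | ⟨b, hxb, hbM, hB⟩
  · exact hbound (hB.mono fun s hs h _ => hs h)
  have hby : y + α * t < b := by
    by_contra! h
    have h1 := hle b y t ht (abs_le.2 ⟨by linarith [(abs_le.1 hxy).1], by linarith⟩)
    nlinarith
  rcases le_or_gt (y + t) b with hbq | hbq
  · exact hbound (hB.mono fun s hs h h' => hs h (h'.trans_le hbq))
  have hαt : 0 < α * t := mul_pos (by linarith) ht
  rcases le_or_gt (y + t / 2) b with hmid | hmid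
  · have h1 := hle b b (y + t - b) (by linarith)
      (by rw [sub_self, abs_zero]; exact mul_nonneg (by linarith) (by linarith))
    have h2 := intervalIntegral_le_of_ae_le hf (p := y) (q := b - (y + t - b)) (B := A)
      (by linarith) (hB.mono fun s hs h3 h4 => (hs h3 (by linarith)).trans hBA.le)
    have h3 := intervalIntegral.integral_add_adjacent_intervals (hf y (b - (y + t - b)))
      (hf (b - (y + t - b)) (y + t))
    rw [show b + (y + t - b) = y + t by ring] at h1
    nlinarith
  · have h1 := hle b (y + t / 2) (t / 2) (by linarith)
      (abs_le.2 ⟨by nlinarith, by linarith⟩)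
    rw [show y + t / 2 - t / 2 = y by ring, show y + t / 2 + t / 2 = y + t by ring] at h1
    nlinarith

theorem not_ae_le_of_isolated_value (hα : 1 / 3 < α)
    (hf : ∀ a b, IntervalIntegrable f volume a b)
    (hle : ∀ x y t : ℝ, 0 < t → |x - y| ≤ α * t → ∫ s in (y - t)..(y + t), f s ≤ M x * (2 * t))
    (hex : ∀ x A : ℝ, A < M x →
      ∃ y t : ℝ, 0 < t ∧ |x - y| ≤ α * t ∧ A * (2 * t) ≤ ∫ s in (y - t)..(y + t), f s)
    {I : Set ℝ} {x B : ℝ}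
    (hl : Iic x ⊆ I ∨ ∃ a, a < x ∧ M a < M x ∧ Ioc a x ⊆ I)
    (hr : Ici x ⊆ I ∨ ∃ b, x < b ∧ M b < M x ∧ Ico x b ⊆ I)
    (hB : B < M x) : ¬ ∀ᵐ s, s ∈ I → f s ≤ B := by
  intro hI
  obtain ⟨A₁, hA₁, hl'⟩ : ∃ A₁, A₁ < M x ∧ ∀ A, A₁ < A →
      (Iic x ⊆ I ∨ ∃ a, a < x ∧ M a < A ∧ Ioc a x ⊆ I) := by
    rcases hl with h | ⟨a, h1, h2, h3⟩
    · exact ⟨B, hB, fun _ _ => Or.inl h⟩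
    · exact ⟨M a, h2, fun A hA => Or.inr ⟨a, h1, hA, h3⟩⟩
  obtain ⟨A₂, hA₂, hr'⟩ : ∃ A₂, A₂ < M x ∧ ∀ A, A₂ < A →
      (Ici x ⊆ I ∨ ∃ b, x < b ∧ M b < A ∧ Ico x b ⊆ I) := by
    rcases hr with h | ⟨b, h1, h2, h3⟩
    · exact ⟨B, hB, fun _ _ => Or.inl h⟩
    · exact ⟨M b, h2, fun A hA => Or.inr ⟨b, h1, hA, h3⟩⟩
  obtain ⟨A, hA, hAM⟩ := exists_between (max_lt hB (max_lt hA₁ hA₂))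
  simp only [max_lt_iff] at hA
  obtain ⟨hBA, hA1, hA2⟩ := hA
  obtain ⟨y, t, ht, hxy, hint⟩ := hex x A hAM
  have hend : ∀ c, M c < A → α * t < |c - y| := fun c hc => by
    by_contra! h
    have := hle c y t ht h
    nlinarith
  have hxy' := abs_le.1 hxy
  have hleft : ∀ s, s ≤ x → y ≤ s → s ∈ I := fun s hs hys => by
    rcases hl' A hA1 with h | ⟨a, hax, haM, h⟩
    · exact h hs
    · refine h ⟨?_, hs⟩
      by_contra! hsa
      refine (hend a haM).not_ge (abs_le.2 ⟨?_, ?_⟩) <;> linarith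
  have hright : ∀ s, x ≤ s → s ≤ y → s ∈ I := fun s hs hys => by
    rcases hr' A hA2 with h | ⟨b, hbx, hbM, h⟩
    · exact h hs
    · refine h ⟨hs, ?_⟩
      by_contra! hsb
      refine (hend b hbM).not_ge (abs_le.2 ⟨?_, ?_⟩) <;> linarith
  have h1 : ∫ s in (y - t)..y, f s < A * t := by
    refine integral_left_half_lt hα hf hle ht hxy hBA hint ?_
    refine (hl' A hA1).imp (fun h => ?_) fun ⟨a, hax, haM, h⟩ => ⟨a, hax, haM, ?_⟩
    · filter_upwards [hI] with s hs hsy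
      exact hs ((le_total s x).elim (fun h' => h h') fun h' => hright s h' hsy.le)
    · filter_upwards [hI] with s hs has hsy
      exact hs ((le_total s x).elim (fun h' => h ⟨has, h'⟩) fun h' => hright s h' hsy.le)
  have h2 : ∫ s in y..(y + t), f s < A * t := by
    refine integral_right_half_lt hα hf hle ht hxy hBA hint ?_
    refine (hr' A hA2).imp (fun h => ?_) fun ⟨b, hbx, hbM, h⟩ => ⟨b, hbx, hbM, ?_⟩
    · filter_upwards [hI] with s hs hsy
      exact hs ((le_total x s).elim (fun h' => h h') fun h' => hleft s h' hsy.le)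
    · filter_upwards [hI] with s hs hys hsb
      exact hs ((le_total x s).elim (fun h' => h ⟨h', hsb⟩) fun h' => hleft s h' hys.le)
  have h3 := intervalIntegral.integral_add_adjacent_intervals (hf (y - t) y) (hf y (y + t))
  nlinarith

theorem eVariationOn_le_of_majorant (hα : 1 / 3 < α)
    (hf : ∀ a b, IntervalIntegrable f volume a b)
    (hle : ∀ x y t : ℝ, 0 < t → |x - y| ≤ α * t → ∫ s in (y - t)..(y + t), f s ≤ M x * (2 * t))
    (hex : ∀ x A : ℝ, A < M x →
      ∃ y t : ℝ, 0 < t ∧ |x - y| ≤ α * t ∧ A * (2 * t) ≤ ∫ s in (y - t)..(y + t), f s)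
    {g : ℝ → ℝ} (hg : BoundedVariationOn g univ) (hfg : ∀ᵐ s, f s ≤ g s)
    (hgM : ∀ x, ∃ r > 0, ∀ᵐ s, |s - x| < r → g s ≤ max (f s) (M x)) :
    eVariationOn M univ ≤ eVariationOn g univ := by
  have key : ∀ (I : Set ℝ) (x ε : ℝ), (Iic x ⊆ I ∨ ∃ a, a < x ∧ M a < M x ∧ Ioc a x ⊆ I) →
      (Ici x ⊆ I ∨ ∃ b, x < b ∧ M b < M x ∧ Ico x b ⊆ I) → 0 < ε →
      ∃ z ∈ I, M x - ε ≤ g z := by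
    intro I x ε hl hr hε
    by_contra! h
    refine not_ae_le_of_isolated_value hα hf hle hex hl hr (by linarith : M x - ε < M x) ?_
    filter_upwards [hfg] with s hs hsI using hs.trans (h s hsI).le
  refine eVariationOn_le_of_attained_maxima hg ?_ ?_ ?_ ?_
  · intro x ε δ hε hδ
    by_contra! h
    obtain ⟨r, hr, hgr⟩ := hgM x
    have hm : 0 < min r δ := lt_min hr hδ
    have h1 := hle x x (min r δ) hm (by
      rw [sub_self, abs_zero]; exact mul_nonneg (by linarith) hm.le)
    have h2 := intervalIntegral_le_of_ae_le (f := fun s => -f s) (fun a b => (hf a b).neg)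
      (p := x - min r δ) (q := x + min r δ) (B := -(M x + ε)) (by linarith) (by
        filter_upwards [hgr] with s hs h3 h4
        have h5 : |s - x| < min r δ := abs_lt.2 ⟨by linarith, by linarith⟩
        have h6 := h s (h5.trans_le (min_le_right _ _))
        rcases le_max_iff.1 (hs (h5.trans_le (min_le_left _ _))) with h7 | h7 <;> linarith)
    rw [intervalIntegral.integral_neg] at h2
    nlinarith
  · intro a x b ε hax hxb ha hb hε
    obtain ⟨z, hz, h⟩ := key (Ioo a b) x ε
      (Or.inr ⟨a, hax, ha, fun s hs => ⟨hs.1, hs.2.trans_lt hxb⟩⟩)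
      (Or.inr ⟨b, hxb, hb, fun s hs => ⟨hax.trans_le hs.1, hs.2⟩⟩) hε
    exact ⟨z, hz.1, hz.2, h⟩
  · intro x b ε hxb hb hε
    exact key (Iio b) x ε (Or.inl fun s hs => lt_of_le_of_lt hs hxb)
      (Or.inr ⟨b, hxb, hb, fun s hs => hs.2⟩) hε
  · intro a x ε hax ha hε
    exact key (Ioi a) x ε (Or.inr ⟨a, hax, ha, fun s hs => hs.1⟩)
      (Or.inl fun s hs => lt_of_lt_of_le hax hs) hε

end

section

variable {f M : ℝ → ℝ}

theorem exists_Ioo_lt_of_variation_minimal (hf : BoundedVariationOn f univ)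
    (hmin : ∀ g : ℝ → ℝ, (∀ᵐ s, f s ≤ g s) →
      (∀ x, ∃ r > 0, ∀ᵐ s, |s - x| < r → g s ≤ max (f s) (M x)) →
      eVariationOn f univ ≤ eVariationOn g univ)
    {x l δ : ℝ} (hl : l < f x) (hδ : 0 < δ) :
    ∃ p q, p < q ∧ x - δ ≤ p ∧ q ≤ x + δ ∧ ∀ s ∈ Ioo p q, l < f s := by
  classical
  have hL := hf.tendsto_leftLim x
  have hR := hf.tendsto_rightLim x
  rcases lt_or_ge l (f.leftLim x) with h | hLl
  · obtain ⟨u, hu, hus⟩ := mem_nhdsLT_iff_exists_Ioo_subset.1 (hL.eventually (lt_mem_nhds h))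
    exact ⟨max u (x - δ), x, max_lt hu (by linarith), le_max_right _ _, by linarith,
      fun s hs => hus ⟨(le_max_left _ _).trans_lt hs.1, hs.2⟩⟩
  rcases lt_or_ge l (f.rightLim x) with h | hRl
  · obtain ⟨u, hu, hus⟩ := mem_nhdsGT_iff_exists_Ioo_subset.1 (hR.eventually (lt_mem_nhds h))
    exact ⟨x, min u (x + δ), lt_min hu (by linarith), by linarith, min_le_right _ _,
      fun s hs => hus ⟨hs.1, hs.2.trans_le (min_le_left _ _)⟩⟩
  exfalso
  obtain ⟨k, hlk, hkx⟩ := exists_between hl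
  obtain ⟨u, hu, hus⟩ :=
    mem_nhdsLT_iff_exists_Ioo_subset.1 (hL.eventually (gt_mem_nhds (hLl.trans_lt hlk)))
  obtain ⟨v, hv, hvs⟩ :=
    mem_nhdsGT_iff_exists_Ioo_subset.1 (hR.eventually (gt_mem_nhds (hRl.trans_lt hlk)))
  obtain ⟨p, hup, hpx⟩ := exists_between (show u < x from hu)
  obtain ⟨q, hxq, hqv⟩ := exists_between (show x < v from hv)
  have heq : ∀ s, s ≠ x → (Icc p q).piecewise (fun x => min (f x) k) f s = f s := fun s hs => by
    by_cases h : s ∈ Icc p q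
    · rw [piecewise_eq_of_mem _ _ _ h]
      refine min_eq_left ?_
      rcases lt_or_gt_of_ne hs with h' | h'
      · exact (show f s < k from hus ⟨hup.trans_le h.1, h'⟩).le
      · exact (show f s < k from hvs ⟨h', h.2.trans_lt hqv⟩).le
    · exact piecewise_eq_of_notMem _ _ _ h
  have hae : ∀ᵐ s : ℝ, s ≠ x := by simp [ae_iff]
  refine (hmin _ ?_ fun y => ⟨1, one_pos, ?_⟩).not_gt
    (eVariationOn_piecewise_min_const_lt hf (b := x) (p := p) (q := q) ⟨hpx.le, hxq.le⟩ hkx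
      (show f p < k from hus ⟨hup, hpx⟩).le (show f q < k from hvs ⟨hxq, hqv⟩).le)
  · filter_upwards [hae] with s hs using (heq s hs).ge
  · filter_upwards [hae] with s hs _ using (heq s hs).le.trans (le_max_left _ _)

theorem min_le_of_variation_minimal {α : ℝ} (hα : 0 < α) (hf0 : ∀ x, 0 ≤ f x)
    (hint : ∀ a b, IntervalIntegrable f volume a b)
    (hle : ∀ x y t : ℝ, 0 < t → |x - y| ≤ α * t → ∫ s in (y - t)..(y + t), f s ≤ M x * (2 * t))
    (hf : BoundedVariationOn f univ)
    (hmin : ∀ g : ℝ → ℝ, (∀ᵐ s, f s ≤ g s) →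
      (∀ x, ∃ r > 0, ∀ᵐ s, |s - x| < r → g s ≤ max (f s) (M x)) →
      eVariationOn f univ ≤ eVariationOn g univ)
    {a b c : ℝ} (hab : a < b) (hbc : b < c) : min (f a) (f c) ≤ f b := by
  classical
  by_contra! hlt
  obtain ⟨k, hbk, hk⟩ := exists_between hlt
  rw [lt_min_iff] at hk
  obtain ⟨a₁, a₂, ha, ha1, ha2, hfa⟩ :=
    exists_Ioo_lt_of_variation_minimal hf hmin hk.1 (show 0 < (b - a) / 2 by linarith)
  obtain ⟨c₁, c₂, hc, hc1, hc2, hfc⟩ :=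
    exists_Ioo_lt_of_variation_minimal hf hmin hk.2 (show 0 < (c - b) / 2 by linarith)
  obtain ⟨p, hp⟩ : ∃ p, p = (a₁ + a₂) / 2 := ⟨_, rfl⟩
  obtain ⟨q, hq⟩ : ∃ q, q = (c₁ + c₂) / 2 := ⟨_, rfl⟩
  obtain ⟨δ, hδ⟩ : ∃ δ, δ = min ((a₂ - a₁) / 2) ((c₂ - c₁) / 2) := ⟨_, rfl⟩
  have hδ0 : 0 < δ := hδ ▸ lt_min (by linarith) (by linarith)
  have hδa : δ ≤ (a₂ - a₁) / 2 := hδ ▸ min_le_left _ _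
  have hδc : δ ≤ (c₂ - c₁) / 2 := hδ ▸ min_le_right _ _
  have hfp : ∀ s, p - δ < s → s < p + δ → k ≤ f s := fun s h1 h2 =>
    (hfa s ⟨by linarith, by linarith⟩).le
  have hfq : ∀ s, q - δ < s → s < q + δ → k ≤ f s := fun s h1 h2 =>
    (hfc s ⟨by linarith, by linarith⟩).le
  have hpb : p < b := by linarith
  have hbq : b < q := by linarith
  have hbdd : BddBelow (f '' Icc p q) := ⟨0, by rintro _ ⟨s, -, rfl⟩; exact hf0 s⟩
  have hbmem : b ∈ Icc p q := ⟨hpb.le, hbq.le⟩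
  obtain ⟨m, hm⟩ : ∃ m, m = sInf (f '' Icc p q) := ⟨_, rfl⟩
  have hmf : ∀ s, p ≤ s → s ≤ q → m ≤ f s := fun s h1 h2 =>
    hm ▸ csInf_le hbdd ⟨s, ⟨h1, h2⟩, rfl⟩
  have hmk : m < k := (hmf b hpb.le hbq.le).trans_lt hbk
  obtain ⟨D, hD⟩ : ∃ D, D = q - p + δ := ⟨_, rfl⟩
  have hD0 : 0 < D := by linarith
  obtain ⟨e, he⟩ : ∃ e, e = (k - m) * δ / D := ⟨_, rfl⟩
  have heD : e * D = (k - m) * δ := by rw [he]; field_simp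
  have he0 : 0 < e := by rw [he]; exact div_pos (mul_pos (by linarith) hδ0) hD0
  have hM : ∀ x ∈ Icc p q, m + e ≤ M x := by
    rintro x ⟨hpx, hxq⟩
    have aux : ∀ t, 0 < t → 2 * t ≤ D →
        m * (2 * t) + (k - m) * δ ≤ ∫ s in (x - t)..(x + t), f s → m + e ≤ M x := by
      intro t ht htD h
      have h1 := hle x x t ht (by rw [sub_self, abs_zero]; positivity)
      have h2 : e * (2 * t) ≤ e * D := mul_le_mul_of_nonneg_left htD he0.le
      by_contra! hcon
      nlinarith
    rcases le_total (x - p) (q - x) with h | h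
    · refine aux (x - p + δ / 2) (by linarith) (by linarith) ?_
      rw [show x - (x - p + δ / 2) = p - δ / 2 by ring]
      have h1 := intervalIntegral.integral_add_adjacent_intervals
        (hint (p - δ / 2) (p + δ / 2)) (hint (p + δ / 2) (x + (x - p + δ / 2)))
      have h2 := le_intervalIntegral_of_le hint (p := p - δ / 2) (q := p + δ / 2) (B := k)
        (by linarith) fun s h3 h4 => hfp s (by linarith) (by linarith)
      have h3 := le_intervalIntegral_of_le hint (p := p + δ / 2) (q := x + (x - p + δ / 2))
        (B := m) (by linarith) fun s h3 h4 => by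
          rcases le_or_gt s q with h5 | h5
          · exact hmf s (by linarith) h5
          · exact hmk.le.trans (hfq s (by linarith) (by linarith))
      linarith
    · refine aux (q - x + δ / 2) (by linarith) (by linarith) ?_
      rw [show x + (q - x + δ / 2) = q + δ / 2 by ring]
      have h1 := intervalIntegral.integral_add_adjacent_intervals
        (hint (x - (q - x + δ / 2)) (q - δ / 2)) (hint (q - δ / 2) (q + δ / 2))
      have h2 := le_intervalIntegral_of_le hint (p := q - δ / 2) (q := q + δ / 2) (B := k)
        (by linarith) fun s h3 h4 => hfq s (by linarith) (by linarith)
      have h3 := le_intervalIntegral_of_le hint (p := x - (q - x + δ / 2)) (q := q - δ / 2)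
        (B := m) (by linarith) fun s h3 h4 => by
          rcases le_or_gt p s with h5 | h5
          · exact hmf s h5 (by linarith)
          · exact hmk.le.trans (hfp s (by linarith) (by linarith))
      linarith
  obtain ⟨l, hl⟩ : ∃ l, l = min (m + e) k := ⟨_, rfl⟩
  have hlk : l ≤ k := hl ▸ min_le_right _ _
  have hle' : l ≤ m + e := hl ▸ min_le_left _ _
  have hml : m < l := hl ▸ lt_min (by linarith) hmk
  obtain ⟨_, ⟨b', hb', rfl⟩, hbl⟩ := exists_lt_of_csInf_lt (s := f '' Icc p q)
    ⟨_, b, hbmem, rfl⟩ (hm ▸ hml)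
  refine (hmin _ (Eventually.of_forall fun s => ?_) fun x => ?_).not_gt
    (eVariationOn_piecewise_max_const_lt hf hb' hbl
      (hlk.trans (hfp p (by linarith) (by linarith)))
      (hlk.trans (hfq q (by linarith) (by linarith))))
  · by_cases h : s ∈ Icc p q
    · rw [piecewise_eq_of_mem _ _ _ h]
      exact le_max_left _ _
    · rw [piecewise_eq_of_notMem _ _ _ h]
  · by_cases hx : x ∈ Icc p q
    · refine ⟨1, one_pos, Eventually.of_forall fun s _ => ?_⟩
      by_cases h : s ∈ Icc p q
      · rw [piecewise_eq_of_mem _ _ _ h]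
        exact max_le_max_left _ (hle'.trans (hM x hx))
      · rw [piecewise_eq_of_notMem _ _ _ h]
        exact le_max_left _ _
    · obtain ⟨r, hr, hball⟩ := Metric.isOpen_iff.1 isClosed_Icc.isOpen_compl x hx
      refine ⟨r, hr, Eventually.of_forall fun s hs => ?_⟩
      rw [piecewise_eq_of_notMem _ _ _ (hball (by rwa [Metric.mem_ball, Real.dist_eq]))]
      exact le_max_left _ _

theorem limit_atBot_eq_limit_atTop {α : ℝ} (hα : 0 < α) (hf0 : ∀ x, 0 ≤ f x)
    (hint : ∀ a b, IntervalIntegrable f volume a b)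
    (hle : ∀ x y t : ℝ, 0 < t → |x - y| ≤ α * t → ∫ s in (y - t)..(y + t), f s ≤ M x * (2 * t))
    (hf : BoundedVariationOn f univ)
    (hmin : ∀ g : ℝ → ℝ, (∀ᵐ s, f s ≤ g s) →
      (∀ x, ∃ r > 0, ∀ᵐ s, |s - x| < r → g s ≤ max (f s) (M x)) →
      eVariationOn f univ ≤ eVariationOn g univ)
    {A B : ℝ} (hA : Tendsto f atBot (𝓝 A)) (hB : Tendsto f atTop (𝓝 B)) : A = B := by
  by_contra hne
  obtain ⟨l, hl, hlAB⟩ := exists_between (show min A B < (A + B) / 2 by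
    rcases lt_or_gt_of_ne hne with h | h
    · rw [min_eq_left h.le]; linarith
    · rw [min_eq_right h.le]; linarith)
  have hlmax : l < max A B := by linarith [le_max_left A B, le_max_right A B]
  obtain ⟨η, hη, hη'⟩ : ∃ η, 0 < η ∧ l + 2 * η = (A + B) / 2 :=
    ⟨((A + B) / 2 - l) / 2, by linarith, by ring⟩
  obtain ⟨P, hP⟩ := eventually_atBot.1 (hA.eventually (lt_mem_nhds (show A - η < A by linarith)))
  obtain ⟨Q, hQ⟩ := eventually_atTop.1 (hB.eventually (lt_mem_nhds (show B - η < B by linarith)))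
  have hM : ∀ x, l ≤ M x := by
    intro x
    obtain ⟨C, hC⟩ : ∃ C, C = (A - η) * (min P Q - x) + (B - η) * (x - Q) := ⟨_, rfl⟩
    obtain ⟨t, h1, h2, h3, h4⟩ : ∃ t, 0 < t ∧ x - t ≤ min P Q ∧ Q ≤ x + t ∧ -C ≤ 2 * η * t := by
      have e1 := eventually_gt_atTop (0 : ℝ)
      have e2 := eventually_ge_atTop (x - min P Q)
      have e3 := eventually_ge_atTop (Q - x)
      have e4 := eventually_ge_atTop (-C / (2 * η))
      obtain ⟨t, ht1, ht2, ht3, ht4⟩ := (e1.and (e2.and (e3.and e4))).exists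
      exact ⟨t, ht1, by linarith, by linarith, by
        rw [div_le_iff₀ (by linarith)] at ht4; linarith⟩
    have h5 := hle x x t h1 (by rw [sub_self, abs_zero]; positivity)
    have i1 := intervalIntegral.integral_add_adjacent_intervals
        (hint (x - t) (min P Q)) (hint (min P Q) Q)
    have i2 := intervalIntegral.integral_add_adjacent_intervals
        (hint (x - t) Q) (hint Q (x + t))
    have j1 := le_intervalIntegral_of_le hint h2 fun s _ hs =>
      (hP s (hs.le.trans (min_le_left _ _))).le
    have j2 := le_intervalIntegral_of_le hint (min_le_right P Q) fun s _ _ => hf0 s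
    have j3 := le_intervalIntegral_of_le hint h3 fun s hs _ => (hQ s hs.le).le
    by_contra! hcon
    nlinarith
  have hex : ∀ {k}, (k = A ∨ k = B) → ∀ U ∈ 𝓝 k, ∃ s, f s ∈ U := by
    rintro k (rfl | rfl) U hU
    · exact (hA.eventually hU).exists
    · exact (hB.eventually hU).exists
  obtain ⟨b, hb⟩ := hex (min_choice A B) _ (gt_mem_nhds hl)
  obtain ⟨c, hc⟩ := hex (max_choice A B) _ (lt_mem_nhds hlmax)
  refine (hmin _ (Eventually.of_forall fun s => le_max_left _ _) fun x =>
    ⟨1, one_pos, Eventually.of_forall fun s _ => max_le_max_left _ (hM x)⟩).not_gt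
    (eVariationOn_max_const_lt hf (mem_univ b) (mem_univ c) hb hc.le)

end

theorem exists_monotoneOn_Iio_antitoneOn_Ioi {f : ℝ → ℝ}
    (hf : ∀ a b c, a < b → b < c → min (f a) (f c) ≤ f b) {L : ℝ}
    (hbot : Tendsto f atBot (𝓝 L)) (htop : Tendsto f atTop (𝓝 L)) :
    ∃ x₀ : ℝ, MonotoneOn f (Iio x₀) ∧ AntitoneOn f (Ioi x₀) := by
  have hanti : ∀ p q r, p < q → q < r → f q < f p → f r ≤ f q := fun p q r h1 h2 h => by
    rcases min_le_iff.1 (hf p q r h1 h2) with h3 | h3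
    · exact absurd h3 h.not_ge
    · exact h3
  by_cases hD : ∃ p q, p < q ∧ f q < f p
  swap
  · push Not at hD
    have hmono : Monotone f := fun x y hxy => hxy.eq_or_lt.elim (fun h => h ▸ le_rfl) (hD x y)
    refine ⟨0, hmono.monotoneOn _, fun x _ y _ _ => ?_⟩
    exact (hmono.ge_of_tendsto htop y).trans (hmono.le_of_tendsto hbot x)
  obtain ⟨p₀, q₀, hpq₀, hfpq₀⟩ := hD
  by_cases hD' : BddBelow {q | ∃ p, p < q ∧ f q < f p}
  · refine ⟨sInf {q | ∃ p, p < q ∧ f q < f p}, fun x _ y hy hxy => ?_, fun x hx y _ hxy => ?_⟩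
    · by_contra! h
      refine (show y < _ from hy).not_ge (csInf_le hD' ⟨x, lt_of_le_of_ne hxy ?_, h⟩)
      rintro rfl
      exact h.false
    · obtain ⟨q, ⟨p, hpq, hfpq⟩, hqx⟩ := exists_lt_of_csInf_lt
        (s := {q | ∃ p, p < q ∧ f q < f p}) ⟨q₀, p₀, hpq₀, hfpq₀⟩ hx
      rcases hxy.eq_or_lt with rfl | hxy
      · exact le_rfl
      · exact hanti p x y (hpq.trans hqx) hxy ((hanti p q x hpq hqx hfpq).trans_lt hfpq)
  · have hA : Antitone f := fun x y hxy => by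
      obtain ⟨q, ⟨p, hpq, hfpq⟩, hqx⟩ := not_bddBelow_iff.1 hD' x
      rcases hxy.eq_or_lt with rfl | hxy
      · exact le_rfl
      · exact hanti p x y (hpq.trans hqx) hxy ((hanti p q x hpq hqx hfpq).trans_lt hfpq)
    refine ⟨0, fun x _ y _ _ => ?_, hA.antitoneOn _⟩
    exact (hA.ge_of_tendsto hbot x).trans (hA.le_of_tendsto htop y)

theorem BoundedVariationOn.exists_abs_le {f : ℝ → ℝ} (hf : BoundedVariationOn f univ) :
    ∃ C, ∀ x, |f x| ≤ C := by
  refine ⟨|f 0| + (eVariationOn f univ).toReal, fun x => ?_⟩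
  have h := hf.dist_le (mem_univ x) (mem_univ 0)
  rw [Real.dist_eq] at h
  linarith [abs_sub_abs_le_abs_sub (f x) (f 0)]

theorem BoundedVariationOn.intervalIntegrable {f : ℝ → ℝ} (hf : BoundedVariationOn f univ)
    (a b : ℝ) : IntervalIntegrable f volume a b := by
  obtain ⟨p, q, hp, hq, rfl⟩ := hf.locallyBoundedVariationOn.exists_monotoneOn_sub_monotoneOn
  exact ((monotoneOn_univ.1 hp).intervalIntegrable).sub ((monotoneOn_univ.1 hq).intervalIntegrable)

theorem integral_le_ntMax_mul {α C : ℝ} {f : ℝ → ℝ} (hf0 : ∀ x, 0 ≤ f x) (hC : ∀ x, |f x| ≤ C)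
    {x y t : ℝ} (ht : 0 < t) (hxy : |x - y| ≤ α * t) :
    ∫ s in (y - t)..(y + t), f s ≤ ntMax α f x * (2 * t) := by
  have hbdd : BddAbove {r : ℝ | ∃ y t : ℝ, 0 < t ∧ |x - y| ≤ α * t ∧ r = avgAbs f y t} := by
    refine ⟨C, ?_⟩
    rintro _ ⟨z, u, hu, -, rfl⟩
    have h := intervalIntegral.norm_integral_le_of_norm_le_const
      (f := fun s => |f s|) (a := z - u) (b := z + u) (C := C) fun s _ => by
        rw [Real.norm_eq_abs, abs_abs]; exact hC s
    rw [show z + u - (z - u) = 2 * u by ring, abs_of_pos (by linarith : (0 : ℝ) < 2 * u)] at h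
    rw [avgAbs, one_div_mul_eq_div, div_le_iff₀ (by linarith)]
    exact (le_abs_self _).trans h
  have h := le_csSup hbdd ⟨y, t, ht, hxy, rfl⟩
  rw [avgAbs, one_div_mul_eq_div, div_le_iff₀ (by linarith)] at h
  simp only [abs_of_nonneg (hf0 _)] at h
  exact h

theorem exists_mul_le_integral_of_lt_ntMax {α A : ℝ} {f : ℝ → ℝ} (hα : 0 ≤ α)
    (hf0 : ∀ x, 0 ≤ f x) {x : ℝ} (hA : A < ntMax α f x) :
    ∃ y t : ℝ, 0 < t ∧ |x - y| ≤ α * t ∧ A * (2 * t) ≤ ∫ s in (y - t)..(y + t), f s := by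
  obtain ⟨_, ⟨y, t, ht, hxy, rfl⟩, h⟩ := exists_lt_of_lt_csSup
    (s := {r : ℝ | ∃ y t : ℝ, 0 < t ∧ |x - y| ≤ α * t ∧ r = avgAbs f y t})
    ⟨avgAbs f x 1, x, 1, one_pos, by simpa using hα, rfl⟩ hA
  refine ⟨y, t, ht, hxy, ?_⟩
  rw [avgAbs, one_div_mul_eq_div, lt_div_iff₀ (by linarith)] at h
  simpa only [abs_of_nonneg (hf0 _)] using h.le

/-- If `α > 1/3` and `f` is a nonnegative function of bounded variation with the NORM(α)
normalization such that `V(M^α f) = V(f)`, then `f` has equal limits at `±∞` and is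
non-decreasing up to some point `x₀` and non-increasing afterwards. -/
theorem extremizer_structure (α : ℝ) (hα : (1 / 3 : ℝ) < α) (f : ℝ → ℝ)
    (hf0 : ∀ x, 0 ≤ f x) (hBV : BoundedVariationOn f Set.univ)
    (hnorm : HasNormAlpha α f)
    (heq : eVariationOn (ntMax α f) Set.univ = eVariationOn f Set.univ) :
    (∃ L : ℝ, Filter.Tendsto f Filter.atBot (𝓝 L) ∧ Filter.Tendsto f Filter.atTop (𝓝 L)) ∧
    (∃ x₀ : ℝ, MonotoneOn f (Set.Iio x₀) ∧ AntitoneOn f (Set.Ioi x₀)) := by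
  have hint := hBV.intervalIntegrable
  obtain ⟨C, hC⟩ := hBV.exists_abs_le
  have hle : ∀ x y t : ℝ, 0 < t → |x - y| ≤ α * t →
      ∫ s in (y - t)..(y + t), f s ≤ ntMax α f x * (2 * t) :=
    fun x y t => integral_le_ntMax_mul hf0 hC
  have hα0 : 0 < α := by linarith
  have hmin : ∀ g : ℝ → ℝ, (∀ᵐ s, f s ≤ g s) →
      (∀ x, ∃ r > 0, ∀ᵐ s, |s - x| < r → g s ≤ max (f s) (ntMax α f x)) →
      eVariationOn f univ ≤ eVariationOn g univ := by
    intro g hfg hgM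
    by_contra! hlt
    refine hlt.not_ge (heq ▸ eVariationOn_le_of_majorant hα hint hle ?_ (hlt.trans_le le_top).ne
      hfg hgM)
    exact fun x A => exists_mul_le_integral_of_lt_ntMax hα0.le hf0
  have hlim := limit_atBot_eq_limit_atTop hα0 hf0 hint hle hBV hmin
    hBV.tendsto_atBot_limUnder hBV.tendsto_atTop_limUnder
  have hbot := hBV.tendsto_atBot_limUnder
  rw [hlim] at hbot
  exact ⟨⟨_, hbot, hBV.tendsto_atTop_limUnder⟩, exists_monotoneOn_Iio_antitoneOn_Ioi
    (fun a b c => min_le_of_variation_minimal hα0 hf0 hint hle hBV hmin) hbot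
    hBV.tendsto_atTop_limUnder⟩
end

section
/- Let α ≥ 0 and let f ∈ W^{1,1}(ℝ), i.e. f is (a.e. equal to) an absolutely continuous function with f ∈ L^1(ℝ) and f' ∈ L^1(ℝ). Then M^α f belongs to W^{1,1}_loc(ℝ); equivalently, M^α f is absolutely continuous on every compact interval of ℝ. -/
open MeasureTheory Set Filter Topology

namespace MaximalVariation

/-- The sum of the drops of `g` from each point of the list to the infimum of `g` up to the next
point of the list. -/
noncomputable def dropSum (g : ℝ → ℝ) : List ℝ → ℝ
  | [] => 0
  | [_] => 0
  | a :: b :: l => (g a - sInf (g '' Icc a b)) + dropSum g (b :: l)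

lemma dropSum_le {g V : ℝ → ℝ} (hV : ∀ x y, x ≤ y → |g x - g y| ≤ V y - V x) {B : ℝ}
    (hB : ∀ x, V x ≤ B) (l : List ℝ) (a : ℝ) (hl : (a :: l).Pairwise (· ≤ ·)) :
    dropSum g (a :: l) ≤ B - V a := by
  induction l generalizing a with
  | nil => simpa [dropSum] using hB a
  | cons b l ih =>
    have hab : a ≤ b := (List.pairwise_cons.1 hl).1 b (by simp)
    have h := ih b (List.pairwise_cons.1 hl).2
    have h2 : g a - (V b - V a) ≤ sInf (g '' Icc a b) := by
      apply le_csInf ((nonempty_Icc.2 hab).image g)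
      rintro _ ⟨x, hx, rfl⟩
      have h3 := (abs_le.1 (hV a x hx.1)).2
      have h4 := (abs_nonneg _).trans (hV x b hx.2)
      linarith
    simp only [dropSum]
    linarith

lemma dropSum_insert_le {g : ℝ → ℝ} (hg : ∀ x, 0 ≤ g x) {S u v z x₁ x₂ : ℝ}
    (hux : u ≤ x₁) (hxz : x₁ < z) (hzx : z < x₂) (hxv : x₂ ≤ v)
    (h₁ : g x₁ + S ≤ g z) (h₂ : g x₂ + S ≤ g z)
    (l : List ℝ) (a : ℝ) (hl : (a :: l).Pairwise (· ≤ ·)) (ha : a ≤ u) (hb : ∃ b ∈ l, v ≤ b)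
    (huv : ∀ x ∈ a :: l, x ∉ Ioo u v) :
    dropSum g (a :: l) + S ≤ dropSum g (a :: l.orderedInsert (· ≤ ·) z) := by
  have bdd : ∀ s : Set ℝ, BddBelow (g '' s) := fun s => ⟨0, by rintro _ ⟨x, -, rfl⟩; exact hg x⟩
  induction l generalizing a with
  | nil => obtain ⟨b, hb, -⟩ := hb; simp at hb
  | cons c l ih =>
    have hac : a ≤ c := (List.pairwise_cons.1 hl).1 c (by simp)
    by_cases hc : c ≤ u
    · have hcz : ¬ z ≤ c := by linarith
      rw [List.orderedInsert_cons, if_neg hcz]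
      simp only [dropSum]
      have h := ih c (List.pairwise_cons.1 hl).2 hc (by
        obtain ⟨b, hb, hvb⟩ := hb
        rcases List.mem_cons.1 hb with rfl | hb
        · exfalso; linarith
        · exact ⟨b, hb, hvb⟩) (fun x hx => huv x (List.mem_cons_of_mem _ hx))
      linarith
    · have hvc : v ≤ c := by
        by_contra! h
        exact huv c (by simp) ⟨not_le.1 hc, h⟩
      rw [List.orderedInsert_cons, if_pos (by linarith)]
      simp only [dropSum]
      have i₁ : sInf (g '' Icc a z) ≤ g z - S :=
        (csInf_le (bdd _) (mem_image_of_mem g (mem_Icc.2 ⟨by linarith, hxz.le⟩))).trans (by linarith)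
      have i₂ : sInf (g '' Icc z c) ≤ g z - S :=
        (csInf_le (bdd _) (mem_image_of_mem (x := x₂) g
          (mem_Icc.2 ⟨by linarith, by linarith⟩))).trans (by linarith)
      have i₃ : min (sInf (g '' Icc a z)) (sInf (g '' Icc z c)) ≤ sInf (g '' Icc a c) := by
        apply le_csInf ((nonempty_Icc.2 hac).image g)
        rintro _ ⟨x, hx, rfl⟩
        rcases le_total x z with h | h
        · exact (min_le_left _ _).trans (csInf_le (bdd _) ⟨x, ⟨hx.1, h⟩, rfl⟩)
        · exact (min_le_right _ _).trans (csInf_le (bdd _) ⟨x, ⟨h, hx.2⟩, rfl⟩)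
      rcases min_le_iff.1 i₃ with h | h <;> linarith

/-- Inside `[lo, hi]`, separated by gaps of length at least `δ`, the function `g` has two hills,
each rising by at least `S` above the points `s₁, p` and `q, s₄` on its two sides. -/
def TwoHills (g : ℝ → ℝ) (δ lo hi S : ℝ) : Prop :=
  ∃ s₁ s₂ p c q s₃ s₄ : ℝ, lo ≤ s₁ - δ ∧ s₁ ≤ s₂ ∧ s₂ ≤ p ∧ p ≤ c ∧ c ≤ q ∧ q ≤ s₃ ∧ s₃ ≤ s₄ ∧
    s₄ + δ ≤ hi ∧ s₂ + δ ≤ c ∧ c + δ ≤ s₃ ∧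
    g s₁ + S ≤ g s₂ ∧ g p + S ≤ g s₂ ∧ g q + S ≤ g s₃ ∧ g s₄ + S ≤ g s₃

lemma TwoHills.mono {g : ℝ → ℝ} {δ δ' lo lo' hi hi' S S' : ℝ} (h : TwoHills g δ lo hi S)
    (hδ : δ' ≤ δ) (hlo : lo' ≤ lo) (hhi : hi ≤ hi') (hS : S' ≤ S) :
    TwoHills g δ' lo' hi' S' := by
  obtain ⟨s₁, s₂, p, c, q, s₃, s₄, h⟩ := h
  exact ⟨s₁, s₂, p, c, q, s₃, s₄, by linarith, by tauto, by tauto, by tauto, by tauto, by tauto,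
    by tauto, by linarith, by linarith, by linarith, by linarith, by linarith, by linarith,
    by linarith⟩

lemma TwoHills.exists_insert {g : ℝ → ℝ} (hg : ∀ x, 0 ≤ g x) {δ lo hi S : ℝ}
    (h : TwoHills g δ lo hi S) (hδ : 0 < δ) (hS : 0 < S) {l : List ℝ} {a : ℝ}
    (hl : (a :: l).Pairwise (· ≤ ·)) (ha : a ≤ lo) (hb : ∃ b ∈ l, hi ≤ b)
    (hsub : ∀ x ∈ a :: l, ∀ y ∈ a :: l, x ∈ Ioo lo hi → y ∈ Ioo lo hi → x = y) :
    ∃ z ∈ Ioo lo hi, (∀ x ∈ a :: l, δ ≤ |z - x|) ∧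
      dropSum g (a :: l) + S ≤ dropSum g (a :: l.orderedInsert (· ≤ ·) z) := by
  obtain ⟨s₁, s₂, p, c, q, s₃, s₄, h1, h2, h3, h4, h5, h6, h7, h8, h9, h10, g1, g2, g3, g4⟩ := h
  obtain ⟨b, hb, hib⟩ := hb
  have lt_of {x y : ℝ} (hxy : x ≤ y) (hne : g x ≠ g y) : x < y :=
    lt_of_le_of_ne hxy (fun h => hne (by rw [h]))
  have e1 : s₁ < s₂ := lt_of h2 (by intro h; linarith)
  have e2 : s₂ < p := lt_of h3 (by intro h; linarith)
  have e3 : q < s₃ := lt_of h6 (by intro h; linarith)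
  have e4 : s₃ < s₄ := lt_of h7 (by intro h; linarith)
  by_cases hx : ∃ x ∈ a :: l, x ∈ Ioo c (s₄ + δ)
  · obtain ⟨x₀, hx₀, hx₀'⟩ := hx
    have key : ∀ x ∈ a :: l, x ∉ Ioo (s₁ - δ) c := by
      intro x hx hx'
      have := hsub x hx x₀ hx₀ ⟨by linarith [hx'.1], by linarith [hx'.2]⟩
        ⟨by linarith [hx₀'.1], by linarith [hx₀'.2]⟩
      linarith [hx'.2, hx₀'.1]
    refine ⟨s₂, ⟨by linarith, by linarith⟩, ?_, ?_⟩
    · intro x hx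
      have := key x hx
      rw [mem_Ioo, not_and_or, not_lt, not_lt] at this
      rcases this with h | h
      · exact le_trans (by linarith) (le_abs_self _)
      · exact le_trans (by linarith) (neg_le_abs _)
    · exact dropSum_insert_le hg (by linarith) e1 e2 h4 g1 g2 l a hl (by linarith)
        ⟨b, hb, by linarith⟩ key
  · have key : ∀ x ∈ a :: l, x ∉ Ioo c (s₄ + δ) := fun x hx' h => hx ⟨x, hx', h⟩
    refine ⟨s₃, ⟨by linarith, by linarith⟩, ?_, ?_⟩
    · intro x hx
      have := key x hx
      rw [mem_Ioo, not_and_or, not_lt, not_lt] at this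
      rcases this with h | h
      · exact le_trans (by linarith) (le_abs_self _)
      · exact le_trans (by linarith) (neg_le_abs _)
    · exact dropSum_insert_le hg h5 e3 e4 (by linarith) g3 g4 l a hl (by linarith)
        ⟨b, hb, by linarith⟩ key

lemma sum_le_of_twoHills_of_separated {ι : Type*} {g V : ℝ → ℝ} (hg : ∀ x, 0 ≤ g x)
    (hV : ∀ x y, x ≤ y → |g x - g y| ≤ V y - V x) {B : ℝ} (hV0 : ∀ x, 0 ≤ V x)
    (hB : ∀ x, V x ≤ B) (K : Finset ι) (rank : ι → ℝ) (δ lo hi S : ι → ℝ)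
    (h : ∀ i ∈ K, TwoHills g (δ i) (lo i) (hi i) (S i)) (hδ : ∀ i ∈ K, 0 < δ i)
    (hS : ∀ i ∈ K, 0 < S i)
    (hsep : ∀ i ∈ K, ∀ j ∈ K, i ≠ j → rank i ≤ rank j →
      Disjoint (Ioo (lo i) (hi i)) (Ioo (lo j) (hi j)) ∨ hi j - lo j ≤ δ i) :
    ∑ i ∈ K, S i ≤ B := by
  classical
  obtain ⟨X, hX⟩ : ∃ X, ∀ i ∈ K, -X ≤ lo i ∧ hi i ≤ X := by
    refine ⟨∑ i ∈ K, (|lo i| + |hi i|), fun i hi' => ?_⟩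
    have := Finset.single_le_sum (f := fun i => |lo i| + |hi i|) (fun i _ => by positivity) hi'
    exact ⟨by linarith [neg_abs_le (lo i), abs_nonneg (hi i)],
      by linarith [le_abs_self (hi i), abs_nonneg (lo i)]⟩
  suffices H : 0 ≤ X → ∃ l : List ℝ, (-X :: l).Pairwise (· ≤ ·) ∧ X ∈ l ∧
      ∑ i ∈ K, S i ≤ dropSum g (-X :: l) ∧
      ∀ lo' hi' : ℝ, -X ≤ lo' → hi' ≤ X →
        (∀ i ∈ K, Disjoint (Ioo (lo i) (hi i)) (Ioo lo' hi') ∨ hi' - lo' ≤ δ i) →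
        ∀ x ∈ -X :: l, ∀ y ∈ -X :: l, x ∈ Ioo lo' hi' → y ∈ Ioo lo' hi' → x = y by
    rcases K.eq_empty_or_nonempty with rfl | ⟨i, hi'⟩
    · simpa using (hV0 0).trans (hB 0)
    · have h0 : 0 ≤ X := by
        have := hX i hi'
        obtain ⟨s₁, s₂, p, c, q, s₃, s₄, h⟩ := h i hi'
        have := hδ i hi'
        linarith
      obtain ⟨l, hl, -, hs, -⟩ := H h0
      linarith [dropSum_le hV hB l _ hl, hV0 (-X)]
  intro hX0
  induction K using Finset.induction_on_max_value rank with
  | empty =>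
    refine ⟨[X], by simp; linarith, by simp, ?_, ?_⟩
    · have h2 : sInf (g '' Icc (-X) X) ≤ g (-X) :=
        csInf_le ⟨0, by rintro _ ⟨x, -, rfl⟩; exact hg x⟩ ⟨-X, ⟨le_rfl, by linarith⟩, rfl⟩
      simp only [dropSum, Finset.sum_empty]
      linarith
    · intro lo' hi' h1 h2 _ x hx y hy hx' hy'
      simp only [List.mem_cons, List.not_mem_nil, or_false] at hx
      rcases hx with rfl | rfl
      · linarith [hx'.1]
      · linarith [hx'.2]
  | insert i K hiK hmax ih =>
    obtain ⟨l, hl, hXl, hs, hsub⟩ := ih (fun j hj => h j (Finset.mem_insert_of_mem hj))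
      (fun j hj => hδ j (Finset.mem_insert_of_mem hj))
      (fun j hj => hS j (Finset.mem_insert_of_mem hj))
      (fun j hj k hk => hsep j (Finset.mem_insert_of_mem hj) k (Finset.mem_insert_of_mem hk))
      (fun j hj => hX j (Finset.mem_insert_of_mem hj))
    have hi' := Finset.mem_insert_self i K
    obtain ⟨z, hz, hzd, hgain⟩ := (h i hi').exists_insert hg (hδ i hi') (hS i hi') hl (hX i hi').1
      ⟨X, hXl, (hX i hi').2⟩ (hsub _ _ (hX i hi').1 (hX i hi').2 fun j hj =>
        hsep j (Finset.mem_insert_of_mem hj) i hi' (by rintro rfl; exact hiK hj) (hmax j hj))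
    have hmem : ∀ x, x ∈ -X :: l.orderedInsert (· ≤ ·) z ↔ x = z ∨ x ∈ -X :: l := by
      intro x; simp only [List.mem_cons, List.mem_orderedInsert]; tauto
    refine ⟨l.orderedInsert (· ≤ ·) z, ?_, ?_, ?_, ?_⟩
    · rw [List.pairwise_cons] at hl ⊢
      refine ⟨fun x hx => ?_, hl.2.orderedInsert z l⟩
      rcases List.mem_orderedInsert (r := (· ≤ ·)).1 hx with rfl | hx
      · linarith [hz.1, (hX i hi').1]
      · exact hl.1 x hx
    · exact List.mem_orderedInsert (r := (· ≤ ·)).2 (Or.inr hXl)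
    · rw [Finset.sum_insert hiK]; linarith
    · intro lo' hi'' h1 h2 h3
      have aux : ∀ x ∈ -X :: l, z ∈ Ioo lo' hi'' → x ∈ Ioo lo' hi'' → False := by
        intro x hx hzi hxi
        rcases h3 i hi' with hd | hd
        · exact Set.disjoint_left.1 hd hz hzi
        · have := hzd x hx
          have : |z - x| < hi'' - lo' := by
            rw [abs_lt]; constructor <;> linarith [hzi.1, hzi.2, hxi.1, hxi.2]
          linarith
      intro x hx y hy hxI hyI
      rw [hmem] at hx hy
      rcases hx with rfl | hx <;> rcases hy with rfl | hy
      · rfl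
      · exact (aux y hy hxI hyI).elim
      · exact (aux x hx hyI hxI).elim
      · exact hsub lo' hi'' h1 h2 (fun j hj => h3 j (Finset.mem_insert_of_mem hj)) x hx y hy hxI hyI

/-- The region assigned to the dyadic cell `[k 2ⁿ / 4, (k + 1) 2ⁿ / 4)` carries two hills. -/
def CellHills (g : ℝ → ℝ) (κ : ℤ × ℤ) (S : ℝ) : Prop :=
  TwoHills g ((2 : ℝ) ^ κ.1 / 8) (κ.2 * ((2 : ℝ) ^ κ.1 / 4) - 9 * 2 ^ κ.1)
    (κ.2 * ((2 : ℝ) ^ κ.1 / 4) + 9 * 2 ^ κ.1) S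

lemma sum_le_of_cellHills {g V : ℝ → ℝ} (hg : ∀ x, 0 ≤ g x)
    (hV : ∀ x y, x ≤ y → |g x - g y| ≤ V y - V x) {B : ℝ} (hV0 : ∀ x, 0 ≤ V x)
    (hB : ∀ x, V x ≤ B) (K : Finset (ℤ × ℤ)) (S : ℤ × ℤ → ℝ)
    (h : ∀ κ ∈ K, CellHills g κ (S κ)) (hS : ∀ κ ∈ K, 0 < S κ) :
    ∑ κ ∈ K, S κ ≤ 640 * B := by
  classical
  let col : ℤ × ℤ → ZMod 8 × ZMod 80 := fun κ => ((κ.1 : ZMod 8), (κ.2 : ZMod 80))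
  rw [← Finset.sum_fiberwise K col S]
  have hcol : ∀ j ∈ (Finset.univ : Finset (ZMod 8 × ZMod 80)),
      ∑ i ∈ K with col i = j, S i ≤ B := by
    intro j _
    refine sum_le_of_twoHills_of_separated hg hV hV0 hB _ (fun κ => -(κ.1 : ℝ)) _ _ _ S
      (fun κ hκ => h κ (Finset.mem_filter.1 hκ).1) (fun κ hκ => by positivity)
      (fun κ hκ => hS κ (Finset.mem_filter.1 hκ).1) ?_
    rintro ⟨n, k⟩ hκ ⟨n', k'⟩ hκ' hne hle
    have hc := (Finset.mem_filter.1 hκ).2.trans (Finset.mem_filter.1 hκ').2.symm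
    simp only [col, Prod.mk.injEq, ZMod.intCast_eq_intCast_iff_dvd_sub] at hc
    obtain ⟨h1, h2⟩ := hc
    simp only [neg_le_neg_iff, Int.cast_le] at hle
    by_cases hn : n = n'
    · subst hn
      left
      have hk : k ≠ k' := fun h => hne (by rw [h])
      have hT : (0 : ℝ) < 2 ^ n := by positivity
      rw [Set.disjoint_left]
      rintro x ⟨hx1, hx2⟩ ⟨hx3, hx4⟩
      simp only at hx1 hx2 hx3 hx4
      have h3 : 80 ≤ k' - k ∨ 80 ≤ k - k' := by
        push_cast at h2
        omega
      rcases h3 with h3 | h3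
      · have : (80 : ℝ) ≤ k' - k := by exact_mod_cast h3
        nlinarith
      · have : (80 : ℝ) ≤ k - k' := by exact_mod_cast h3
        nlinarith
    · right
      have h3 : n' + 8 ≤ n := by
        push_cast at h1
        omega
      have h4 : (2 : ℝ) ^ (n' + 8) ≤ 2 ^ n := zpow_le_zpow_right₀ (by norm_num) h3
      rw [zpow_add₀ (by norm_num)] at h4
      norm_num at h4
      have hT : (0 : ℝ) < 2 ^ n' := by positivity
      simp only
      linarith
  refine (Finset.sum_le_sum hcol).trans ?_
  simp [ZMod.card]

lemma exists_mul_le_integral {g : ℝ → ℝ} (hg : Continuous g) {a b : ℝ} (hab : a ≤ b) :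
    ∃ s ∈ Icc a b, (b - a) * g s ≤ ∫ x in a..b, g x := by
  obtain ⟨s, hs, hmin⟩ := isCompact_Icc.exists_isMinOn (nonempty_Icc.2 hab) hg.continuousOn
  refine ⟨s, hs, ?_⟩
  have := intervalIntegral.integral_mono_on hab (intervalIntegrable_const (μ := volume) (c := g s))
    (hg.intervalIntegrable a b) (fun x hx => hmin hx)
  simpa using this

lemma exists_integral_le_mul {g : ℝ → ℝ} (hg : Continuous g) {a b : ℝ} (hab : a ≤ b) :
    ∃ s ∈ Icc a b, ∫ x in a..b, g x ≤ (b - a) * g s := by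
  obtain ⟨s, hs, h⟩ := exists_mul_le_integral hg.neg hab
  refine ⟨s, hs, ?_⟩
  simp only [Pi.neg_apply, intervalIntegral.integral_neg] at h
  linarith

/-- `m` dominates all centred averages of the nonnegative continuous function `g`. -/
structure IsMajorant (g m : ℝ → ℝ) : Prop where
  cont : Continuous g
  nonneg : ∀ x, 0 ≤ g x
  le : ∀ x, g x ≤ m x
  avg_le : ∀ x t, 0 < t → ∫ s in (x - t)..(x + t), g s ≤ 2 * t * m x

lemma IsMajorant.comp_neg {g m : ℝ → ℝ} (h : IsMajorant g m) :
    IsMajorant (fun x => g (-x)) (fun x => m (-x)) where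
  cont := h.cont.comp continuous_neg
  nonneg x := h.nonneg _
  le x := h.le _
  avg_le x t ht := by
    rw [intervalIntegral.integral_comp_neg (fun x => g x)]
    convert h.avg_le (-x) t ht using 2 <;> ring

/-- Data of a point `r` between `p` and `q`, with a radius `t` and a value `A`. -/
structure Peak where
  p : ℝ
  r : ℝ
  q : ℝ
  t : ℝ
  A : ℝ

/-- The total rise of the value of the peak above the values of `m` at its end points. -/
def Peak.rise (m : ℝ → ℝ) (P : Peak) : ℝ := (P.A - m P.p) + (P.A - m P.q)

/-- The reflection of a peak at the origin. -/
def Peak.reflect (P : Peak) : Peak := ⟨-P.q, -P.r, -P.p, P.t, P.A⟩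

/-- The average of `g` on `[r - t, r + t]` is `A` and exceeds the values of `m` at the end points
of `[p, q] ∋ r`. -/
structure Peak.IsValid (g m : ℝ → ℝ) (P : Peak) : Prop where
  p_lt : P.p < P.r
  lt_q : P.r < P.q
  t_pos : 0 < P.t
  integral_eq : ∫ s in (P.r - P.t)..(P.r + P.t), g s = 2 * P.t * P.A
  left_lt : m P.p < P.A
  right_lt : m P.q < P.A

lemma Peak.IsValid.reflect {g m : ℝ → ℝ} {P : Peak} (h : P.IsValid g m) :
    P.reflect.IsValid (fun x => g (-x)) (fun x => m (-x)) where
  p_lt := neg_lt_neg h.lt_q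
  lt_q := neg_lt_neg h.p_lt
  t_pos := h.t_pos
  integral_eq := by
    rw [intervalIntegral.integral_comp_neg (fun x => g x)]
    simp only [Peak.reflect]
    convert h.integral_eq using 2 <;> ring
  left_lt := by simpa [Peak.reflect] using h.right_lt
  right_lt := by simpa [Peak.reflect] using h.left_lt

lemma Peak.rise_reflect {m : ℝ → ℝ} {P : Peak} :
    P.reflect.rise (fun x => m (-x)) = P.rise m := by
  simp [Peak.rise, Peak.reflect]; ring

lemma Peak.IsValid.rise_pos {g m : ℝ → ℝ} {P : Peak} (h : P.IsValid g m) : 0 < P.rise m := by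
  have := h.left_lt
  have := h.right_lt
  simp only [Peak.rise]
  linarith

lemma Peak.reflect_reflect (P : Peak) : P.reflect.reflect = P := by
  simp [Peak.reflect]

lemma IsMajorant.exists_low_left {g m : ℝ → ℝ} (hm : IsMajorant g m) {P : Peak}
    (h : P.IsValid g m) {x : ℝ} (hx : x < P.r) :
    ∃ s ∈ Icc (P.r - P.t - 2 * (P.r - x)) (P.r - P.t),
      (P.r - x) * g s ≤ (P.r - x) * P.A - (P.r - x + P.t) * (P.A - m x) := by
  obtain ⟨s, hs, h1⟩ := exists_mul_le_integral hm.cont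
    (show P.r - P.t - 2 * (P.r - x) ≤ P.r - P.t by linarith)
  refine ⟨s, hs, ?_⟩
  have h2 := hm.avg_le x (P.t + (P.r - x)) (by linarith [h.t_pos])
  rw [show x - (P.t + (P.r - x)) = P.r - P.t - 2 * (P.r - x) by ring,
    show x + (P.t + (P.r - x)) = P.r + P.t by ring,
    ← intervalIntegral.integral_add_adjacent_intervals (b := P.r - P.t)
    (hm.cont.intervalIntegrable _ _) (hm.cont.intervalIntegrable _ _), h.integral_eq] at h2
  linarith

lemma IsMajorant.le_integral_left {g m : ℝ → ℝ} (hm : IsMajorant g m) {P : Peak}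
    (h : P.IsValid g m) {x : ℝ} (hxt : x < P.r + P.t) :
    2 * (x - P.r) * P.A + 2 * (P.t - (x - P.r)) * (P.A - m x) ≤
      ∫ s in (P.r - P.t)..(P.r - P.t + 2 * (x - P.r)), g s := by
  have h2 := hm.avg_le x (P.t - (x - P.r)) (by linarith)
  have h3 := h.integral_eq
  rw [← intervalIntegral.integral_add_adjacent_intervals (b := P.r - P.t + 2 * (x - P.r))
    (hm.cont.intervalIntegrable _ _) (hm.cont.intervalIntegrable _ _)] at h3
  rw [show x - (P.t - (x - P.r)) = P.r - P.t + 2 * (x - P.r) by ring,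
    show x + (P.t - (x - P.r)) = P.r + P.t by ring] at h2
  linarith

lemma IsMajorant.exists_high_left {g m : ℝ → ℝ} (hm : IsMajorant g m) {P : Peak}
    (h : P.IsValid g m) {x : ℝ} (hx : P.r < x) (hxt : x < P.r + P.t) :
    ∃ s ∈ Icc (P.r - P.t) (P.r - P.t + 2 * (x - P.r)),
      (x - P.r) * P.A + (P.t - (x - P.r)) * (P.A - m x) ≤ (x - P.r) * g s := by
  obtain ⟨s, hs, h1⟩ := exists_integral_le_mul hm.cont
    (show P.r - P.t ≤ P.r - P.t + 2 * (x - P.r) by linarith)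
  refine ⟨s, hs, ?_⟩
  have := hm.le_integral_left h hxt
  linarith

/-- On the interval of the peak, `g` stays well below the value of the peak. -/
def Peak.IsDeep (g m : ℝ → ℝ) (P : Peak) : Prop := ∀ x ∈ Icc P.p P.q, g x < P.A - P.rise m / 4

lemma Peak.IsDeep.reflect {g m : ℝ → ℝ} {P : Peak} (h : P.IsDeep g m) :
    P.reflect.IsDeep (fun x => g (-x)) (fun x => m (-x)) := by
  intro x hx
  rw [Peak.rise_reflect]
  exact h (-x) ⟨by linarith [hx.2, show P.reflect.q = -P.p from rfl],
    by linarith [hx.1, show P.reflect.p = -P.q from rfl]⟩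

lemma IsMajorant.lt_add_of_isDeep {g m : ℝ → ℝ} (hm : IsMajorant g m) {P : Peak}
    (h : P.IsValid g m) (hd : P.IsDeep g m) : P.q < P.r + P.t := by
  have aux : ∀ {g m : ℝ → ℝ} (_ : IsMajorant g m) {P : Peak} (_ : P.IsValid g m)
      (_ : P.IsDeep g m), P.q < P.r + P.t ∨ P.r - P.t < P.p := by
    intro g m hm P h hd
    by_contra! hc
    obtain ⟨s, hs, h1⟩ := exists_integral_le_mul hm.cont
      (show P.r - P.t ≤ P.r + P.t by linarith [h.t_pos])
    rw [h.integral_eq] at h1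
    have h2 := hd s ⟨by linarith [hs.1], by linarith [hs.2]⟩
    nlinarith [h.rise_pos, h.t_pos]
  have aux2 : ∀ {g m : ℝ → ℝ} (_ : IsMajorant g m) {P : Peak} (_ : P.IsValid g m)
      (_ : P.IsDeep g m), P.q < P.r + P.t → P.r - P.t < P.p := by
    intro g m hm P h hd hq
    by_contra! hc
    obtain ⟨s, hs, h1⟩ := hm.exists_high_left h h.lt_q hq
    have h2 := hd s ⟨by linarith [hs.1], by linarith [hs.2]⟩
    nlinarith [h.rise_pos, h.lt_q, h.right_lt]
  rcases aux hm h hd with h1 | h1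
  · exact h1
  · have h2 := aux2 hm.comp_neg h.reflect hd.reflect
    simp only [Peak.reflect] at h2
    linarith [h2 (by linarith)]

/-- A deep peak produces a hill of `g` to its left. -/
lemma IsMajorant.exists_hill_left {g m : ℝ → ℝ} (hm : IsMajorant g m) {P : Peak}
    (h : P.IsValid g m) (hd : P.IsDeep g m) (hp : P.r - P.t < P.p) :
    ∃ s₁ s₂, P.r - 3 * P.t ≤ s₁ ∧ s₁ ≤ s₂ ∧ s₂ ≤ P.p ∧ s₂ ≤ P.r - P.t + 2 * (P.q - P.r) ∧
      g s₁ + P.rise m / 4 ≤ g s₂ ∧ g P.p + P.rise m / 4 ≤ g s₂ := by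
  have hq := hm.lt_add_of_isDeep h hd
  have h1 := h.left_lt
  have h2 := h.right_lt
  have h3 := h.p_lt
  have h4 := h.lt_q
  have h5 := h.t_pos
  have h6 := hd P.p ⟨le_rfl, by linarith⟩
  obtain ⟨s₁, hs₁, hl⟩ := hm.exists_low_left h h.p_lt
  have hl' : g s₁ ≤ P.A - 2 * (P.A - m P.p) := by
    have : (P.r - P.p) * g s₁ ≤ (P.r - P.p) * (P.A - 2 * (P.A - m P.p)) := by nlinarith
    exact le_of_mul_le_mul_left this (by linarith)
  obtain ⟨s₂, hs₂, hs₂', hs₂'', hh⟩ : ∃ s₂, P.r - P.t ≤ s₂ ∧ s₂ ≤ P.p ∧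
      s₂ ≤ P.r - P.t + 2 * (P.q - P.r) ∧ P.A + (P.A - m P.q) / 4 ≤ g s₂ := by
    rcases le_total (P.r - P.t + 2 * (P.q - P.r)) P.p with hc | hc
    · obtain ⟨s, hs, h7⟩ := hm.exists_high_left h h.lt_q hq
      refine ⟨s, hs.1, hs.2.trans hc, hs.2, ?_⟩
      have : (P.q - P.r) * (P.A + (P.A - m P.q) / 4) ≤ (P.q - P.r) * g s := by nlinarith
      exact le_of_mul_le_mul_left this (by linarith)
    · obtain ⟨s, hs, h7⟩ := exists_integral_le_mul hm.cont hp.le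
      refine ⟨s, hs.1, hs.2, hs.2.trans hc, ?_⟩
      have h8 := hm.le_integral_left h hq
      rw [← intervalIntegral.integral_add_adjacent_intervals (b := P.p)
        (hm.cont.intervalIntegrable _ _) (hm.cont.intervalIntegrable _ _)] at h8
      have h9 := intervalIntegral.integral_mono_on hc (hm.cont.intervalIntegrable _ _)
        (intervalIntegrable_const (μ := volume) (c := P.A - P.rise m / 4))
        (fun x hx => (hd x ⟨hx.1, by linarith [hx.2]⟩).le)
      rw [intervalIntegral.integral_const, smul_eq_mul] at h9
      have : (P.p - (P.r - P.t)) * (P.A + (P.A - m P.q) / 4) ≤ (P.p - (P.r - P.t)) * g s := by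
        simp only [Peak.rise] at h9
        nlinarith [mul_nonneg (sub_nonneg.2 hc) (sub_pos.2 h1).le,
          mul_nonneg (sub_pos.2 hq).le (sub_pos.2 h2).le,
          mul_nonneg (sub_pos.2 h3).le (sub_pos.2 h2).le]
      exact le_of_mul_le_mul_left this (by linarith)
  refine ⟨s₁, s₂, by linarith [hs₁.1], by linarith [hs₁.2], hs₂', hs₂'', ?_, by linarith⟩
  simp only [Peak.rise]
  linarith

lemma IsMajorant.twoHills_of_isDeep {g m : ℝ → ℝ} (hm : IsMajorant g m) {P : Peak}
    (h : P.IsValid g m) (hd : P.IsDeep g m) :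
    TwoHills g (P.t / 8) (P.r - 4 * P.t) (P.r + 4 * P.t) (P.rise m / 4) := by
  have hq := hm.lt_add_of_isDeep h hd
  have hp := hm.comp_neg.lt_add_of_isDeep h.reflect hd.reflect
  have hp' : P.r - P.t < P.p := by simp only [Peak.reflect] at hp; linarith
  obtain ⟨s₁, s₂, a1, a2, a3, a4, a5, a6⟩ := hm.exists_hill_left h hd hp'
  obtain ⟨s₄, s₃, b1, b2, b3, b4, b5, b6⟩ := hm.comp_neg.exists_hill_left h.reflect hd.reflect
    (by simp only [Peak.reflect]; linarith)
  rw [Peak.rise_reflect] at b5 b6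
  simp only [Peak.reflect, neg_neg] at b1 b2 b3 b4 b5 b6
  have h3 := h.p_lt
  have h4 := h.lt_q
  have h5 := h.t_pos
  refine ⟨s₁, s₂, P.p, (P.p + P.q) / 2, P.q, -s₃, -s₄, by linarith, a2, a3, by linarith,
    by linarith, by linarith, by linarith, by linarith, ?_, ?_, a5, a6, b6, b5⟩
  · rcases le_total (P.t / 4) (P.q - P.p) with hc | hc <;> linarith
  · rcases le_total (P.t / 4) (P.q - P.p) with hc | hc <;> linarith

/-- The intervals of the peaks in `s` do not overlap. -/
def NonOverlapping (s : Finset Peak) : Prop :=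
  ∀ P ∈ s, ∀ Q ∈ s, P ≠ Q → P.q ≤ Q.p ∨ Q.q ≤ P.p

lemma NonOverlapping.mono {s s' : Finset Peak} (h : NonOverlapping s) (hs : s' ⊆ s) :
    NonOverlapping s' := fun P hP Q hQ => h P (hs hP) Q (hs hQ)

lemma Peak.reflect_injective : Function.Injective Peak.reflect :=
  Function.Involutive.injective Peak.reflect_reflect

/-- If the value of each peak exceeds the values of `m` to its right by little, then the total rise
of the peaks is small. -/
lemma sum_rise_le {m : ℝ → ℝ} {σ v : ℝ} (hσ : 0 ≤ σ) (P₀ : Peak) (s : Finset Peak)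
    (hP₀ : P₀ ∈ s) (hmin : ∀ P ∈ s, P₀.p ≤ P.p) (hs : NonOverlapping s)
    (hpr : ∀ P ∈ s, P.p < P.r) (hrq : ∀ P ∈ s, P.r < P.q) (hqv : ∀ P ∈ s, P.q ≤ v)
    (hmA : ∀ P ∈ s, m P.p < P.A)
    (hdrop : ∀ P ∈ s, m P₀.p - σ * (P.r - P₀.r) ≤ P.A → ∀ x, P.r < x → x ≤ v →
      P.A - m x ≤ σ * (x - P.r)) :
    ∀ P ∈ s, (∀ Q ∈ s, Q.r ≤ P.r) → m P₀.p - σ * (P.r - P₀.r) ≤ P.A ∧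
      ∑ Q ∈ s, Q.rise m ≤ P.A - m P₀.p + σ * (P.r - P₀.r) + σ * (P.q - P₀.r) := by
  classical
  induction s using Finset.induction_on_max_value Peak.r with
  | empty => simp at hP₀
  | insert P s hPs hmax ih =>
    have hself := Finset.mem_insert_self P s
    have hsub := Finset.subset_insert P s
    have hlast : ∀ Q ∈ insert P s, (∀ Q' ∈ insert P s, Q'.r ≤ Q.r) → Q = P := by
      intro Q hQ hQm
      by_contra hne
      have hQs : Q ∈ s := (Finset.mem_insert.1 hQ).resolve_left hne
      have h1 := le_antisymm (hmax Q hQs) (hQm P hself)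
      rcases hs Q hQ P hself hne with h | h
      · linarith [hrq Q hQ, hpr P hself]
      · linarith [hrq P hself, hpr Q hQ]
    intro P' hP' hP'm
    obtain rfl := hlast P' hP' hP'm
    rw [Finset.sum_insert hPs]
    rcases s.eq_empty_or_nonempty with rfl | hne
    · obtain rfl : P₀ = P' := by simpa using hP₀
      have h1 := hmA P₀ hself
      have h2 : m P₀.p - σ * (P₀.r - P₀.r) ≤ P₀.A := by linarith
      have h3 := hdrop P₀ hself h2 P₀.q (hrq P₀ hself) (hqv P₀ hself)
      refine ⟨h2, ?_⟩
      simp only [Peak.rise, Finset.sum_empty]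
      linarith
    · obtain ⟨Q, hQ, hQm⟩ := s.exists_max_image Peak.r hne
      have hQ' := hsub hQ
      have hQP : Q ≠ P' := by rintro rfl; exact hPs hQ
      have hov : Q.q ≤ P'.p := by
        rcases hs Q hQ' P' hself hQP with h | h
        · exact h
        · linarith [hrq P' hself, hpr Q hQ', hmax Q hQ]
      have hP₀s : P₀ ∈ s := by
        rcases Finset.mem_insert.1 hP₀ with rfl | h
        · linarith [hmin Q hQ', hpr Q hQ', hrq Q hQ']
        · exact h
      obtain ⟨h1, h2⟩ := ih hP₀s (fun R hR => hmin R (hsub hR)) (hs.mono hsub)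
        (fun R hR => hpr R (hsub hR)) (fun R hR => hrq R (hsub hR)) (fun R hR => hqv R (hsub hR))
        (fun R hR => hmA R (hsub hR)) (fun R hR => hdrop R (hsub hR)) Q hQ hQm
      have h3 := hpr P' hself
      have h4 := hrq P' hself
      have h5 := hrq Q hQ'
      have h6 := hmA P' hself
      have h7 := hdrop Q hQ' h1 P'.p (by linarith) (by linarith [hqv P' hself])
      have h8 : m P₀.p - σ * (P'.r - P₀.r) ≤ P'.A := by nlinarith
      have h9 := hdrop P' hself h8 P'.q h4 (hqv P' hself)
      refine ⟨h8, ?_⟩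
      simp only [Peak.rise] at h2 ⊢
      nlinarith

lemma IsMajorant.exists_hill_left_of_lt {g m : ℝ → ℝ} (hm : IsMajorant g m) {P : Peak}
    (h : P.IsValid g m) {p x D : ℝ} (hp : p ≤ P.p) (hpD : P.r - p ≤ D) (hx : P.r < x)
    (hxD : x - P.r ≤ D) (hD : D < P.t) :
    ∃ s₁ s₂, P.r - P.t - 2 * D ≤ s₁ ∧ s₁ ≤ s₂ ∧ s₂ ≤ P.r - P.t + 2 * D ∧ g s₁ ≤ m p ∧
      (x - P.r) * P.A + (P.t - (x - P.r)) * (P.A - m x) ≤ (x - P.r) * g s₂ := by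
  obtain ⟨s₂, hs₂, h2⟩ := hm.exists_high_left h hx (by linarith)
  have h3 := h.p_lt
  have h4 := h.t_pos
  have h5 := h.left_lt
  obtain ⟨s₁, hs₁, hs₁', h1⟩ : ∃ s₁, P.r - P.t - 2 * D ≤ s₁ ∧ s₁ ≤ P.r - P.t ∧ g s₁ ≤ m p := by
    rcases le_total (m p) P.A with hc | hc
    · obtain ⟨s, hs, h1⟩ := hm.exists_low_left h (show p < P.r by linarith)
      refine ⟨s, by linarith [hs.1], hs.2, ?_⟩
      have : (P.r - p) * g s ≤ (P.r - p) * m p := by nlinarith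
      exact le_of_mul_le_mul_left this (by linarith)
    · obtain ⟨s, hs, h1⟩ := hm.exists_low_left h h3
      refine ⟨s, by linarith [hs.1], hs.2, ?_⟩
      have : (P.r - P.p) * g s ≤ (P.r - P.p) * m p := by nlinarith
      exact le_of_mul_le_mul_left this (by linarith)
  exact ⟨s₁, s₂, hs₁, by linarith [hs₂.1], by linarith [hs₂.2], h1, h2⟩

/-- A cluster of peaks of comparable radii in a short interval produces a hill to its left whose
height is comparable to the total rise of the cluster. -/
lemma IsMajorant.exists_hill_left_of_cluster {g m : ℝ → ℝ} (hm : IsMajorant g m) {T u : ℝ}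
    (hT : 0 < T) (s : Finset Peak) (hs : NonOverlapping s) (hv : ∀ P ∈ s, P.IsValid g m)
    (hup : ∀ P ∈ s, u ≤ P.p) (hqu : ∀ P ∈ s, P.q ≤ u + T / 4) (hTt : ∀ P ∈ s, T ≤ P.t)
    (htT : ∀ P ∈ s, P.t < 2 * T) (P₀ : Peak) (hP₀ : P₀ ∈ s) (hmin : ∀ P ∈ s, P₀.p ≤ P.p) :
    ∃ s₁ s₂, u - 3 * T ≤ s₁ ∧ s₁ ≤ s₂ ∧ s₂ ≤ u - T / 4 ∧
      g s₁ + (∑ P ∈ s, P.rise m) / 4 ≤ g s₂ ∧ g P₀.p + (∑ P ∈ s, P.rise m) / 4 ≤ g s₂ := by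
  set β := (∑ P ∈ s, P.rise m) / 4 with hβ
  have hβ0 : 0 < β := by
    have := Finset.sum_pos (fun P hP => (hv P hP).rise_pos) ⟨P₀, hP₀⟩
    linarith
  by_contra! hno
  have key : ∀ P ∈ s, ∀ x, P.r < x → x ≤ u + T / 4 → m x ≤ P.A →
      P.A - m P₀.p < β ∧
      (P.t - (x - P.r)) * (P.A - m x) ≤ (x - P.r) * (β - (P.A - m P₀.p)) := by
    intro P hP x hx hxu hmx
    have h1 := hv P hP
    have h2 := h1.p_lt
    have h3 := h1.lt_q
    obtain ⟨s₁, s₂, b1, b2, b3, b4, b5⟩ := hm.exists_hill_left_of_lt h1 (hmin P hP) (D := T / 4)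
      (by linarith [hqu P hP, hup P₀ hP₀]) hx (by linarith [hup P hP]) (by linarith [hTt P hP])
    have b6 : g s₂ < m P₀.p + β := by
      by_contra! hc
      have := hno s₁ s₂ (by linarith [hup P hP, htT P hP]) b2
        (by linarith [hqu P hP, hTt P hP]) (by linarith)
      linarith [hm.le P₀.p]
    have b7 : 0 ≤ (P.t - (x - P.r)) * (P.A - m x) :=
      mul_nonneg (by linarith [hTt P hP, hup P hP]) (by linarith)
    constructor
    · have : (x - P.r) * P.A ≤ (x - P.r) * g s₂ := by linarith
      linarith [le_of_mul_le_mul_left this (by linarith)]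
    · nlinarith
  have hdrop : ∀ P ∈ s, m P₀.p - 4 * β / T * (P.r - P₀.r) ≤ P.A → ∀ x, P.r < x → x ≤ u + T / 4 →
      P.A - m x ≤ 4 * β / T * (x - P.r) := by
    intro P hP hA x hx hxu
    have h0 := hv P hP
    rcases le_total P.A (m x) with hc | hc
    · have : 0 ≤ 4 * β / T * (x - P.r) := mul_nonneg (by positivity) (by linarith)
      linarith
    · obtain ⟨-, h2⟩ := key P hP x hx hxu hc
      have h3 : β - (P.A - m P₀.p) ≤ 2 * β := by
        have : 4 * β / T * (P.r - P₀.r) ≤ 4 * β / T * (T / 4) :=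
          mul_le_mul_of_nonneg_left (by
            linarith [hqu P hP, hup P₀ hP₀, (hv P₀ hP₀).p_lt, h0.lt_q]) (by positivity)
        rw [show 4 * β / T * (T / 4) = β by field_simp] at this
        linarith
      have h4 : T / 2 * (P.A - m x) ≤ (x - P.r) * (2 * β) := by
        have h5 : T / 2 ≤ P.t - (x - P.r) := by linarith [hTt P hP, hup P hP, h0.p_lt]
        have h6 := mul_le_mul_of_nonneg_right h5 (sub_nonneg.2 hc)
        have h7 := mul_le_mul_of_nonneg_left h3 (sub_pos.2 hx).le
        linarith
      rw [div_mul_eq_mul_div, le_div_iff₀ hT]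
      linarith
  obtain ⟨P, hP, hPm⟩ := s.exists_max_image Peak.r ⟨P₀, hP₀⟩
  obtain ⟨h1, h2⟩ := sum_rise_le (by positivity) P₀ s hP₀ hmin hs (fun P hP => (hv P hP).p_lt)
    (fun P hP => (hv P hP).lt_q) hqu (fun P hP => (hv P hP).left_lt) hdrop P hP hPm
  have h3 := (key P hP P.q (hv P hP).lt_q (hqu P hP) (hv P hP).right_lt.le).1
  have h4 : ∀ y, y ≤ T / 4 → 4 * β / T * y ≤ β := by
    intro y hy
    have : 4 * β / T * y ≤ 4 * β / T * (T / 4) := mul_le_mul_of_nonneg_left hy (by positivity)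
    rwa [show 4 * β / T * (T / 4) = β by field_simp] at this
  have h5 := h4 (P.r - P₀.r) (by linarith [hqu P hP, hup P₀ hP₀, (hv P₀ hP₀).p_lt, (hv P hP).lt_q])
  have h6 := h4 (P.q - P₀.r) (by linarith [hqu P hP, hup P₀ hP₀, (hv P₀ hP₀).p_lt])
  linarith

lemma IsMajorant.twoHills_of_cluster {g m : ℝ → ℝ} (hm : IsMajorant g m) {T u : ℝ}
    (hT : 0 < T) (s : Finset Peak) (hne : s.Nonempty) (hs : NonOverlapping s)
    (hv : ∀ P ∈ s, P.IsValid g m)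
    (hup : ∀ P ∈ s, u ≤ P.p) (hqu : ∀ P ∈ s, P.q ≤ u + T / 4) (hTt : ∀ P ∈ s, T ≤ P.t)
    (htT : ∀ P ∈ s, P.t < 2 * T) :
    TwoHills g (T / 8) (u - 4 * T) (u + 4 * T) ((∑ P ∈ s, P.rise m) / 4) := by
  classical
  obtain ⟨P₀, hP₀, hmin⟩ := s.exists_min_image Peak.p hne
  obtain ⟨P₁, hP₁, hmax⟩ := s.exists_max_image Peak.q hne
  obtain ⟨s₁, s₂, a1, a2, a3, a4, a5⟩ :=
    hm.exists_hill_left_of_cluster hT s hs hv hup hqu hTt htT P₀ hP₀ hmin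
  have hmem : ∀ {φ : Peak → Prop}, (∀ P ∈ s, φ P.reflect) → ∀ P ∈ s.image Peak.reflect, φ P := by
    intro φ h P hP
    obtain ⟨Q, hQ, rfl⟩ := Finset.mem_image.1 hP
    exact h Q hQ
  obtain ⟨s₄, s₃, b1, b2, b3, b4, b5⟩ :=
    hm.comp_neg.exists_hill_left_of_cluster (u := -(u + T / 4)) hT (s.image Peak.reflect)
      (by
        refine hmem fun P hP => hmem fun Q hQ hPQ => ?_
        have := hs P hP Q hQ (fun h => hPQ (by rw [h]))
        simp only [Peak.reflect, neg_le_neg_iff]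
        tauto)
      (hmem fun P hP => (hv P hP).reflect)
      (hmem fun P hP => by simp only [Peak.reflect]; linarith [hqu P hP])
      (hmem fun P hP => by simp only [Peak.reflect]; linarith [hup P hP])
      (hmem fun P hP => hTt P hP) (hmem fun P hP => htT P hP) P₁.reflect
      (Finset.mem_image_of_mem _ hP₁)
      (hmem fun P hP => neg_le_neg (hmax P hP))
  rw [Finset.sum_image (fun _ _ _ _ h => Peak.reflect_injective h)] at b4 b5
  simp only [Peak.rise_reflect] at b4 b5
  simp only [Peak.reflect, neg_neg] at b5
  have h1 := hup P₀ hP₀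
  have h2 := hqu P₀ hP₀
  have h3 := (hv P₀ hP₀).p_lt
  have h4 := (hv P₀ hP₀).lt_q
  have h5 := hmax P₀ hP₀
  exact ⟨s₁, s₂, P₀.p, P₀.p, P₁.q, -s₃, -s₄, by linarith, a2, by linarith, le_rfl, by linarith,
    by linarith [hqu P₁ hP₁], by linarith, by linarith, by linarith, by linarith, a4, a5, b5, b4⟩

lemma sum_sub_le_of_nonoverlapping {ι : Type*} {V : ℝ → ℝ} {lo hi : ℝ} (hlo : lo ≤ hi)
    (hV : MonotoneOn V (Icc lo hi)) (s : Finset ι) (p q : ι → ℝ) (hpq : ∀ i ∈ s, p i < q i)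
    (hp : ∀ i ∈ s, lo ≤ p i) (hq : ∀ i ∈ s, q i ≤ hi)
    (hs : ∀ i ∈ s, ∀ j ∈ s, i ≠ j → q i ≤ p j ∨ q j ≤ p i) :
    ∑ i ∈ s, (V (q i) - V (p i)) ≤ V hi - V lo := by
  classical
  induction s using Finset.induction_on_max_value q generalizing hi with
  | empty => simpa using hV ⟨le_rfl, hlo⟩ ⟨hlo, le_rfl⟩ hlo
  | insert i s his hmax ih =>
    have hself := Finset.mem_insert_self i s
    have hsub := Finset.subset_insert i s
    have h1 := hpq i hself
    have h2 := hq i hself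
    have h3 := hp i hself
    have h4 := ih h3 (hV.mono (Icc_subset_Icc_right (by linarith)))
      (fun j hj => hpq j (hsub hj)) (fun j hj => hp j (hsub hj)) (fun j hj => by
        rcases hs j (hsub hj) i hself (by rintro rfl; exact his hj) with h | h
        · exact h
        · linarith [hpq j (hsub hj), hmax j hj])
      (fun j hj k hk => hs j (hsub hj) k (hsub hk))
    have h5 := hV ⟨by linarith, h2⟩ ⟨hlo, le_rfl⟩ h2
    rw [Finset.sum_insert his]
    linarith

/-- The dyadic cell containing a peak. -/
noncomputable def Peak.cell (P : Peak) : ℤ × ℤ :=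
  (Int.log 2 P.t, ⌊P.r / ((2 : ℝ) ^ Int.log 2 P.t / 4)⌋)

lemma Peak.cell_spec {P : Peak} (ht : 0 < P.t) :
    (2 : ℝ) ^ P.cell.1 ≤ P.t ∧ P.t < 2 * 2 ^ P.cell.1 ∧
    P.cell.2 * ((2 : ℝ) ^ P.cell.1 / 4) ≤ P.r ∧
    P.r < P.cell.2 * ((2 : ℝ) ^ P.cell.1 / 4) + (2 : ℝ) ^ P.cell.1 / 4 := by
  have hT : (0 : ℝ) < (2 : ℝ) ^ P.cell.1 / 4 := by positivity
  refine ⟨by exact_mod_cast Int.zpow_log_le_self (b := 2) (by norm_num) ht, ?_, ?_, ?_⟩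
  · have := Int.lt_zpow_succ_log_self (b := 2) (by norm_num) P.t
    rw [zpow_add_one₀ (by norm_num)] at this
    simp only [Peak.cell]
    push_cast at this
    linarith
  · rw [← le_div_iff₀ hT]
    exact Int.floor_le _
  · rw [← add_one_mul, ← div_lt_iff₀ hT]
    exact Int.lt_floor_add_one _

lemma IsMajorant.cellHills_of_isDeep {g m : ℝ → ℝ} (hm : IsMajorant g m) {P : Peak}
    (h : P.IsValid g m) (hd : P.IsDeep g m) : CellHills g P.cell (P.rise m / 4) := by
  obtain ⟨h1, h2, h3, h4⟩ := P.cell_spec h.t_pos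
  exact (hm.twoHills_of_isDeep h hd).mono (by linarith) (by linarith) (by linarith) le_rfl

section Variation

variable {g m V : ℝ → ℝ} {B : ℝ}

lemma IsMajorant.sum_rise_le_of_cellHills (hm : IsMajorant g m)
    (hV : ∀ x y, x ≤ y → |g x - g y| ≤ V y - V x) (hV0 : ∀ x, 0 ≤ V x)
    (hB : ∀ x, V x ≤ B) (s : Finset Peak) (hv : ∀ P ∈ s, P.IsValid g m)
    (h : ∀ κ, (∃ P ∈ s, P.cell = κ) →
      CellHills g κ ((∑ P ∈ s with P.cell = κ, P.rise m) / 4)) :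
    ∑ P ∈ s, P.rise m ≤ 2560 * B := by
  classical
  have h1 := sum_le_of_cellHills hm.nonneg hV hV0 hB (s.image Peak.cell)
    (fun κ => (∑ P ∈ s with P.cell = κ, P.rise m) / 4)
    (fun κ hκ => h κ (by simpa using hκ))
    (fun κ hκ => by
      obtain ⟨P, hP, rfl⟩ := Finset.mem_image.1 hκ
      have : 0 < ∑ Q ∈ s with Q.cell = P.cell, Q.rise m :=
        Finset.sum_pos (fun Q hQ => (hv Q (Finset.mem_filter.1 hQ).1).rise_pos)
          ⟨P, Finset.mem_filter.2 ⟨hP, rfl⟩⟩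
      linarith)
  rw [← Finset.sum_div,
    Finset.sum_fiberwise_of_maps_to (fun P hP => Finset.mem_image_of_mem Peak.cell hP)] at h1
  linarith

lemma IsMajorant.sum_rise_le_of_injOn (hm : IsMajorant g m)
    (hV : ∀ x y, x ≤ y → |g x - g y| ≤ V y - V x) (hV0 : ∀ x, 0 ≤ V x)
    (hB : ∀ x, V x ≤ B) (s : Finset Peak) (hv : ∀ P ∈ s, P.IsValid g m)
    (hd : ∀ P ∈ s, P.IsDeep g m) (hinj : ∀ P ∈ s, ∀ Q ∈ s, P.cell = Q.cell → P = Q) :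
    ∑ P ∈ s, P.rise m ≤ 2560 * B := by
  classical
  refine hm.sum_rise_le_of_cellHills hV hV0 hB s hv ?_
  rintro _ ⟨P, hP, rfl⟩
  have : s.filter (fun Q => Q.cell = P.cell) = {P} := by
    ext Q
    simp only [Finset.mem_filter, Finset.mem_singleton]
    exact ⟨fun h => hinj Q h.1 P hP h.2, by rintro rfl; exact ⟨hP, rfl⟩⟩
  rw [this, Finset.sum_singleton]
  exact hm.cellHills_of_isDeep (hv P hP) (hd P hP)

lemma Peak.rise_le_of_not_isDeep (hm : IsMajorant g m)
    (hV : ∀ x y, x ≤ y → |g x - g y| ≤ V y - V x) {P : Peak}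
    (hd : ¬ P.IsDeep g m) : P.rise m ≤ 2 * (V P.q - V P.p) := by
  simp only [Peak.IsDeep, not_forall, not_lt] at hd
  obtain ⟨x, hx, hgx⟩ := hd
  have h1 := (abs_le.1 (hV _ _ hx.1)).1
  have h2 := (abs_le.1 (hV _ _ hx.2)).2
  have h3 := hm.le P.p
  have h4 := hm.le P.q
  simp only [Peak.rise] at hgx ⊢
  linarith

lemma sum_sub_le_of_monotone (hV : Monotone V) (hV0 : ∀ x, 0 ≤ V x) (hB : ∀ x, V x ≤ B)
    (s : Finset Peak) (hpq : ∀ P ∈ s, P.p < P.q) (hs : NonOverlapping s) :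
    ∑ P ∈ s, (V P.q - V P.p) ≤ B := by
  obtain ⟨X, hX⟩ : ∃ X, ∀ P ∈ s, -X ≤ P.p ∧ P.q ≤ X := by
    refine ⟨∑ P ∈ s, (|P.p| + |P.q|), fun P hP => ?_⟩
    have := Finset.single_le_sum (f := fun P : Peak => |P.p| + |P.q|)
      (fun i _ => by positivity) hP
    exact ⟨by linarith [neg_abs_le P.p, abs_nonneg P.q],
      by linarith [le_abs_self P.q, abs_nonneg P.p]⟩
  rcases s.eq_empty_or_nonempty with rfl | ⟨P, hP⟩
  · simpa using (hV0 0).trans (hB 0)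
  · have := sum_sub_le_of_nonoverlapping (V := V) (lo := -X) (hi := X)
      (by linarith [hX P hP, hpq P hP]) (hV.monotoneOn _) s Peak.p Peak.q hpq
      (fun P hP => (hX P hP).1) (fun P hP => (hX P hP).2) hs
    linarith [hV0 (-X), hB X]

/-- The total rise of a family of non-overlapping peaks is bounded by the variation of `g`. -/
theorem IsMajorant.sum_rise_le (hm : IsMajorant g m)
    (hV : ∀ x y, x ≤ y → |g x - g y| ≤ V y - V x) (hV0 : ∀ x, 0 ≤ V x)
    (hB : ∀ x, V x ≤ B) (s : Finset Peak) (hs : NonOverlapping s)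
    (hv : ∀ P ∈ s, P.IsValid g m) : ∑ P ∈ s, P.rise m ≤ 7682 * B := by
  classical
  have hVm : Monotone V := fun x y hxy => by linarith [abs_nonneg (g x - g y), hV x y hxy]
  set left : Peak → ℝ := fun P => P.cell.2 * ((2 : ℝ) ^ P.cell.1 / 4) with hleft
  set len : Peak → ℝ := fun P => (2 : ℝ) ^ P.cell.1 / 4 with hlen
  have hcell : ∀ P Q : Peak, P.cell = Q.cell → left P = left Q ∧ len P = len Q := by
    intro P Q h
    simp only [hleft, hlen, h, and_self]
  have hspec : ∀ P ∈ s, left P ≤ P.r ∧ P.r < left P + len P := fun P hP =>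
    (P.cell_spec (hv P hP).t_pos).2.2
  rw [← Finset.sum_filter_not_add_sum_filter s (fun P => P.IsDeep g m)]
  set s' := s.filter (fun P => P.IsDeep g m) with hs'
  have hs's : s' ⊆ s := Finset.filter_subset _ _
  rw [← Finset.sum_filter_add_sum_filter_not s' (fun P => P.p < left P)]
  set s'' := s'.filter (fun P => ¬ P.p < left P) with hs''
  have hs''s : s'' ⊆ s' := Finset.filter_subset _ _
  rw [← Finset.sum_filter_add_sum_filter_not s'' (fun P => left P + len P < P.q)]
  have b1 : ∑ P ∈ s with ¬ P.IsDeep g m, P.rise m ≤ 2 * B := by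
    have h1 : ∑ P ∈ s with ¬ P.IsDeep g m, P.rise m ≤
        ∑ P ∈ s with ¬ P.IsDeep g m, 2 * (V P.q - V P.p) := by
      refine Finset.sum_le_sum fun P hP => ?_
      have := Finset.mem_filter.1 hP
      exact Peak.rise_le_of_not_isDeep hm hV this.2
    rw [← Finset.mul_sum] at h1
    have h2 := sum_sub_le_of_monotone hVm hV0 hB (s.filter (fun P => ¬ P.IsDeep g m))
      (fun P hP => by
        have := hv P (Finset.mem_filter.1 hP).1
        linarith [this.p_lt, this.lt_q]) (hs.mono (Finset.filter_subset _ _))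
    linarith
  have b2 : ∑ P ∈ s' with P.p < left P, P.rise m ≤ 2560 * B := by
    refine hm.sum_rise_le_of_injOn hV hV0 hB _
      (fun P hP => hv P (hs's (Finset.mem_filter.1 hP).1))
      (fun P hP => (Finset.mem_filter.1 (Finset.mem_filter.1 hP).1).2) ?_
    intro P hP Q hQ hPQ
    obtain ⟨hP1, hP2⟩ := Finset.mem_filter.1 hP
    obtain ⟨hQ1, hQ2⟩ := Finset.mem_filter.1 hQ
    by_contra hne
    obtain ⟨e1, e2⟩ := hcell P Q hPQ
    have := hspec P (hs's hP1)
    have := hspec Q (hs's hQ1)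
    rcases hs P (hs's hP1) Q (hs's hQ1) hne with h | h
    · linarith [(hv P (hs's hP1)).lt_q]
    · linarith [(hv Q (hs's hQ1)).lt_q]
  have b3 : ∑ P ∈ s'' with left P + len P < P.q, P.rise m ≤ 2560 * B := by
    refine hm.sum_rise_le_of_injOn hV hV0 hB _
      (fun P hP => hv P (hs's (hs''s (Finset.mem_filter.1 hP).1)))
      (fun P hP => (Finset.mem_filter.1 (hs''s (Finset.mem_filter.1 hP).1)).2) ?_
    intro P hP Q hQ hPQ
    obtain ⟨hP1, hP2⟩ := Finset.mem_filter.1 hP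
    obtain ⟨hQ1, hQ2⟩ := Finset.mem_filter.1 hQ
    replace hP1 := hs's (hs''s hP1)
    replace hQ1 := hs's (hs''s hQ1)
    by_contra hne
    obtain ⟨e1, e2⟩ := hcell P Q hPQ
    have := hspec P hP1
    have := hspec Q hQ1
    rcases hs P hP1 Q hQ1 hne with h | h
    · linarith [(hv Q hQ1).p_lt]
    · linarith [(hv P hP1).p_lt]
  have b4 : ∑ P ∈ s'' with ¬ left P + len P < P.q, P.rise m ≤ 2560 * B := by
    set w := s''.filter (fun P => ¬ left P + len P < P.q) with hw
    have hws : ∀ P ∈ w, P ∈ s ∧ left P ≤ P.p ∧ P.q ≤ left P + len P := fun P hP => by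
      obtain ⟨h1, h2⟩ := Finset.mem_filter.1 hP
      exact ⟨hs's (hs''s h1), not_lt.1 (Finset.mem_filter.1 h1).2, not_lt.1 h2⟩
    refine hm.sum_rise_le_of_cellHills hV hV0 hB w (fun P hP => hv P (hws P hP).1) ?_
    rintro _ ⟨P₀, hP₀, rfl⟩
    have hT : (0 : ℝ) < 2 ^ P₀.cell.1 := by positivity
    have hmem : ∀ P ∈ w.filter (fun P => P.cell = P₀.cell), P ∈ s ∧ left P₀ ≤ P.p ∧
        P.q ≤ left P₀ + len P₀ ∧ P.cell.1 = P₀.cell.1 := fun P hP => by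
      obtain ⟨h1, h2⟩ := Finset.mem_filter.1 hP
      obtain ⟨h3, h4, h5⟩ := hws P h1
      obtain ⟨e1, e2⟩ := hcell P P₀ h2
      exact ⟨h3, by linarith, by linarith, by rw [h2]⟩
    have := hm.twoHills_of_cluster (u := left P₀) hT (w.filter (fun P => P.cell = P₀.cell))
      ⟨P₀, Finset.mem_filter.2 ⟨hP₀, rfl⟩⟩ (hs.mono fun P hP => (hmem P hP).1)
      (fun P hP => hv P (hmem P hP).1) (fun P hP => (hmem P hP).2.1)
      (fun P hP => (hmem P hP).2.2.1)
      (fun P hP => by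
        obtain ⟨h1, -, -, h2⟩ := hmem P hP
        rw [← h2]
        exact (P.cell_spec (hv P h1).t_pos).1)
      (fun P hP => by
        obtain ⟨h1, -, -, h2⟩ := hmem P hP
        rw [← h2]
        exact (P.cell_spec (hv P h1).t_pos).2.1)
    exact this.mono le_rfl (by simp only [hleft]; linarith) (by simp only [hleft]; linarith) le_rfl
  linarith

end Variation

section NtMax

variable {f : ℝ → ℝ} {α C : ℝ}

lemma integral_eq_avgAbs (f : ℝ → ℝ) (y : ℝ) {t : ℝ} (ht : 0 < t) :
    ∫ s in (y - t)..(y + t), |f s| = 2 * t * avgAbs f y t := by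
  rw [avgAbs]; field_simp

lemma avgAbs_le_of_forall_le (hc : Continuous f) {y t c : ℝ} (ht : 0 < t)
    (h : ∀ s ∈ Icc (y - t) (y + t), |f s| ≤ c) : avgAbs f y t ≤ c := by
  have h1 := intervalIntegral.integral_mono_on (show y - t ≤ y + t by linarith)
    (hc.abs.intervalIntegrable _ _) (intervalIntegrable_const (μ := volume) (c := c)) h
  rw [intervalIntegral.integral_const, smul_eq_mul, integral_eq_avgAbs f y ht] at h1
  have : 2 * t * avgAbs f y t ≤ 2 * t * c := by linarith
  exact le_of_mul_le_mul_left this (by linarith)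

lemma le_avgAbs_of_forall_le (hc : Continuous f) {y t c : ℝ} (ht : 0 < t)
    (h : ∀ s ∈ Icc (y - t) (y + t), c ≤ |f s|) : c ≤ avgAbs f y t := by
  have h1 := intervalIntegral.integral_mono_on (show y - t ≤ y + t by linarith)
    (intervalIntegrable_const (μ := volume) (c := c)) (hc.abs.intervalIntegrable _ _) h
  rw [intervalIntegral.integral_const, smul_eq_mul, integral_eq_avgAbs f y ht] at h1
  have : 2 * t * c ≤ 2 * t * avgAbs f y t := by linarith
  exact le_of_mul_le_mul_left this (by linarith)

lemma bddAbove_averages (hc : Continuous f) (hC : ∀ x, |f x| ≤ C) (x : ℝ) :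
    BddAbove {r : ℝ | ∃ y t : ℝ, 0 < t ∧ |x - y| ≤ α * t ∧ r = avgAbs f y t} := by
  refine ⟨C, ?_⟩
  rintro _ ⟨y, t, ht, -, rfl⟩
  exact avgAbs_le_of_forall_le hc ht fun s _ => hC s

lemma avgAbs_le_ntMax (hc : Continuous f) (hC : ∀ x, |f x| ≤ C) {x y t : ℝ} (ht : 0 < t)
    (hxy : |x - y| ≤ α * t) : avgAbs f y t ≤ ntMax α f x :=
  le_csSup (bddAbove_averages hc hC x) ⟨y, t, ht, hxy, rfl⟩

lemma averages_nonempty (hα : 0 ≤ α) (f : ℝ → ℝ) (x : ℝ) :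
    {r : ℝ | ∃ y t : ℝ, 0 < t ∧ |x - y| ≤ α * t ∧ r = avgAbs f y t}.Nonempty :=
  ⟨_, x, 1, one_pos, by simpa using hα, rfl⟩

lemma ntMax_le (hα : 0 ≤ α) (hc : Continuous f) (hC : ∀ x, |f x| ≤ C) (x : ℝ) :
    ntMax α f x ≤ C := by
  refine csSup_le (averages_nonempty hα f x) ?_
  rintro _ ⟨y, t, ht, -, rfl⟩
  exact avgAbs_le_of_forall_le hc ht fun s _ => hC s

lemma exists_lt_avgAbs (hα : 0 ≤ α) {x c : ℝ} (h : c < ntMax α f x) :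
    ∃ y t, 0 < t ∧ |x - y| ≤ α * t ∧ c < avgAbs f y t := by
  obtain ⟨_, ⟨y, t, ht, hxy, rfl⟩, hlt⟩ := exists_lt_of_lt_csSup (averages_nonempty hα f x) h
  exact ⟨y, t, ht, hxy, hlt⟩

lemma abs_le_ntMax (hα : 0 ≤ α) (hc : Continuous f) (hC : ∀ x, |f x| ≤ C) (x : ℝ) :
    |f x| ≤ ntMax α f x := by
  refine le_of_forall_pos_sub_le fun ε hε => ?_
  obtain ⟨δ, hδ, h⟩ := Metric.continuousAt_iff.1 hc.abs.continuousAt ε hε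
  refine le_trans (le_avgAbs_of_forall_le hc (y := x) (half_pos hδ) fun s hs => ?_)
    (avgAbs_le_ntMax hc hC (x := x) (half_pos hδ) ?_)
  · have h1 := h (show dist s x < δ by
      rw [Real.dist_eq, abs_lt]; constructor <;> linarith [hs.1, hs.2])
    rw [Real.dist_eq] at h1
    linarith [(abs_lt.1 h1).1]
  · simpa using mul_nonneg hα (half_pos hδ).le

lemma isMajorant_ntMax (hα : 0 ≤ α) (hc : Continuous f) (hC : ∀ x, |f x| ≤ C) :
    IsMajorant (fun x => |f x|) (ntMax α f) where
  cont := hc.abs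
  nonneg _ := abs_nonneg _
  le := abs_le_ntMax hα hc hC
  avg_le x t ht := by
    rw [integral_eq_avgAbs f x ht]
    exact mul_le_mul_of_nonneg_left
      (avgAbs_le_ntMax hc hC ht (by simpa using mul_nonneg hα ht.le)) (by linarith)

lemma exists_peak (hα : 0 ≤ α) (hc : Continuous f) (hC : ∀ x, |f x| ≤ C) {p r q : ℝ}
    (hpr : p < r) (hrq : r < q) (h₁ : ntMax α f p < ntMax α f r)
    (h₂ : ntMax α f q < ntMax α f r) :
    ∃ P : Peak, P.p = p ∧ P.q = q ∧ P.IsValid (fun x => |f x|) (ntMax α f) ∧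
      (ntMax α f r - ntMax α f p) + (ntMax α f r - ntMax α f q) ≤ 2 * P.rise (ntMax α f) := by
  obtain ⟨y, t, ht, hry, hlt⟩ := exists_lt_avgAbs (f := f) hα (x := r)
    (c := max ((ntMax α f r + ntMax α f p) / 2) ((ntMax α f r + ntMax α f q) / 2))
    (max_lt (by linarith) (by linarith))
  obtain ⟨hl₁, hl₂⟩ := max_lt_iff.1 hlt
  have hy := abs_le.1 hry
  refine ⟨⟨p, y, q, t, avgAbs f y t⟩, rfl, rfl, ⟨?_, ?_, ht, integral_eq_avgAbs f y ht, ?_, ?_⟩, ?_⟩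
  · by_contra! hyp
    simp only at hyp
    linarith [avgAbs_le_ntMax hc hC (x := p) (α := α) ht (by
      rw [abs_le]; constructor <;> linarith)]
  · by_contra! hyp
    simp only at hyp
    linarith [avgAbs_le_ntMax hc hC (x := q) (α := α) ht (by
      rw [abs_le]; constructor <;> linarith)]
  · simp only; linarith
  · simp only; linarith
  · simp only [Peak.rise]; linarith

lemma exists_peaks_of_monotone (hα : 0 ≤ α) (hc : Continuous f) (hC : ∀ x, |f x| ≤ C)
    {u : ℕ → ℝ} (hu : Monotone u) (n : ℕ) :
    ∃ s : Finset Peak, NonOverlapping s ∧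
      (∀ P ∈ s, P.IsValid (fun x => |f x|) (ntMax α f)) ∧
      (((∀ P ∈ s, P.q ≤ u n) ∧
        ∑ i ∈ Finset.range n, |ntMax α f (u (i + 1)) - ntMax α f (u i)| ≤
          2 * ∑ P ∈ s, P.rise (ntMax α f) + C - ntMax α f (u n)) ∨
      ∃ p r, p < r ∧ r ≤ u n ∧ (∀ P ∈ s, P.q ≤ p) ∧ ntMax α f p < ntMax α f r ∧
        ntMax α f (u n) ≤ ntMax α f r ∧
        ∑ i ∈ Finset.range n, |ntMax α f (u (i + 1)) - ntMax α f (u i)| ≤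
          2 * ∑ P ∈ s, P.rise (ntMax α f) + C + (ntMax α f r - ntMax α f p) +
            (ntMax α f r - ntMax α f (u n))) := by
  classical
  have hC' := ntMax_le hα hc hC
  have h0 : ∀ x, 0 ≤ ntMax α f x := fun x => (abs_nonneg _).trans (abs_le_ntMax hα hc hC x)
  set M := ntMax α f with hM
  induction n with
  | zero =>
    refine ⟨∅, by simp [NonOverlapping], by simp, Or.inl ⟨by simp, ?_⟩⟩
    simpa using hC' (u 0)
  | succ n ih =>
    obtain ⟨s, hs, hv, ih⟩ := ih
    have hmono : u n ≤ u (n + 1) := hu n.le_succ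
    rw [Finset.sum_range_succ]
    rcases ih with ⟨hq, hsum⟩ | ⟨p, r, hpr, hru, hq, hMp, hMu, hsum⟩
    · rcases le_or_gt (M (u (n + 1))) (M (u n)) with h | h
      · refine ⟨s, hs, hv, Or.inl ⟨fun P hP => (hq P hP).trans hmono, ?_⟩⟩
        rw [abs_of_nonpos (by linarith)]
        linarith
      · refine ⟨s, hs, hv, Or.inr ⟨u n, u (n + 1), lt_of_le_of_ne hmono ?_, le_rfl, hq, h, le_rfl,
          ?_⟩⟩
        · intro he
          rw [he] at h
          exact lt_irrefl _ h
        · rw [abs_of_pos (by linarith)]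
          linarith [h0 (u n)]
    · rcases le_or_gt (M (u (n + 1))) (M (u n)) with h | h
      · refine ⟨s, hs, hv, Or.inr ⟨p, r, hpr, hru.trans hmono, hq, hMp, h.trans hMu, ?_⟩⟩
        rw [abs_of_nonpos (by linarith)]
        linarith
      · have hlt : u n < u (n + 1) := lt_of_le_of_ne hmono (by
          intro he
          rw [he] at h
          exact lt_irrefl _ h)
        rcases hMu.eq_or_lt with he | hl
        · refine ⟨s, hs, hv, Or.inr ⟨p, u (n + 1), by linarith, le_rfl, hq, by linarith, le_rfl,
            ?_⟩⟩
          rw [abs_of_pos (by linarith)]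
          linarith
        · have hru' : r < u n := lt_of_le_of_ne hru (by
            rintro rfl
            exact lt_irrefl _ hl)
          obtain ⟨P, rfl, hPq, hPv, hPr⟩ := exists_peak hα hc hC hpr hru' hMp hl
          have hPs : P ∉ s := fun hP => by linarith [hq P hP, hPv.p_lt, hPv.lt_q]
          refine ⟨insert P s, ?_, ?_, Or.inr ⟨u n, u (n + 1), hlt, le_rfl, ?_, h, le_rfl, ?_⟩⟩
          · intro Q hQ R hR hne
            rcases Finset.mem_insert.1 hQ with rfl | hQs <;>
              rcases Finset.mem_insert.1 hR with rfl | hRs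
            · exact absurd rfl hne
            · exact Or.inr (hq R hRs)
            · exact Or.inl (hq Q hQs)
            · exact hs Q hQs R hRs hne
          · intro Q hQ
            rcases Finset.mem_insert.1 hQ with rfl | hQ
            · exact hPv
            · exact hv Q hQ
          · intro Q hQ
            rcases Finset.mem_insert.1 hQ with rfl | hQ
            · exact hPq.le
            · linarith [hq Q hQ]
          · rw [abs_of_pos (by linarith), Finset.sum_insert hPs]
            linarith

/-- The nontangential maximal function of a bounded continuous function of bounded variation has
bounded variation. -/
theorem boundedVariationOn_ntMax (hα : 0 ≤ α) (hc : Continuous f) (hC : ∀ x, |f x| ≤ C)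
    {V : ℝ → ℝ} {B : ℝ} (hV : ∀ x y, x ≤ y → |(|f x| - |f y|)| ≤ V y - V x)
    (hV0 : ∀ x, 0 ≤ V x) (hB : ∀ x, V x ≤ B) : BoundedVariationOn (ntMax α f) univ := by
  have hC' := ntMax_le hα hc hC
  have h0 : ∀ x, 0 ≤ ntMax α f x := fun x => (abs_nonneg _).trans (abs_le_ntMax hα hc hC x)
  refine ne_top_of_le_ne_top (ENNReal.ofReal_ne_top (r := 2 * (7682 * B) + 3 * C)) ?_
  refine iSup_le ?_
  rintro ⟨n, u, hu, -⟩
  simp only [edist_dist, Real.dist_eq]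
  rw [← ENNReal.ofReal_sum_of_nonneg fun _ _ => abs_nonneg _]
  refine ENNReal.ofReal_le_ofReal ?_
  obtain ⟨s, hs, hv, h⟩ := exists_peaks_of_monotone hα hc hC hu n
  have h1 := (isMajorant_ntMax hα hc hC).sum_rise_le hV hV0 hB s hs hv
  rcases h with ⟨-, h⟩ | ⟨p, r, -, -, -, -, -, h⟩
  · linarith [h0 (u n), (h0 0).trans (hC' 0)]
  · linarith [h0 (u n), hC' r, h0 p]

end NtMax

lemma edist_add_eVariationOn_le {w v m : ℝ → ℝ}
    (h : ∀ x y, |w x - w y| = |v x - v y| + |m x - m y|) {x y : ℝ} (hxy : x ≤ y) :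
    edist (m x) (m y) + eVariationOn v (Icc x y) ≤ eVariationOn w (Icc x y) := by
  have he : ∀ x y, edist (w x) (w y) = edist (v x) (v y) + edist (m x) (m y) := fun x y => by
    simp only [edist_dist, Real.dist_eq]
    rw [h, ENNReal.ofReal_add (abs_nonneg _) (abs_nonneg _)]
  have hm : ∀ x y, edist (m x) (m y) ≤ edist (w x) (w y) := fun x y => by
    rw [he]; exact le_add_self
  have : Nonempty {u : ℕ → ℝ // Monotone u ∧ ∀ i, u i ∈ Icc x y} :=
    ⟨⟨fun _ => x, monotone_const, fun _ => ⟨le_rfl, hxy⟩⟩⟩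
  rw [eVariationOn, ENNReal.add_iSup]
  refine iSup_le ?_
  rintro ⟨n, u, hu, hus⟩
  have h1 : ∀ k, edist (m (u 0)) (m (u k)) ≤
      ∑ i ∈ Finset.range k, edist (m (u (i + 1))) (m (u i)) := fun k => by
    refine (edist_le_range_sum_edist (fun i => m (u i)) k).trans_eq ?_
    simp only [edist_comm]
  have h2 : ∑ i ∈ Finset.range n, edist (w (u (i + 1))) (w (u i)) ≤
      eVariationOn w (Icc (u 0) (u n)) :=
    eVariationOn.sum_le_of_monotoneOn_Iic (f := w) (hu.monotoneOn _)
      fun i hi => ⟨hu i.zero_le, hu hi⟩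
  have h3 : edist (w x) (w (u 0)) ≤ eVariationOn w (Icc x (u 0)) :=
    eVariationOn.edist_le w ⟨le_rfl, (hus 0).1⟩ ⟨(hus 0).1, le_rfl⟩
  have h4 : edist (w (u n)) (w y) ≤ eVariationOn w (Icc (u n) y) :=
    eVariationOn.edist_le w ⟨le_rfl, (hus n).2⟩ ⟨(hus n).2, le_rfl⟩
  have h5 : eVariationOn w (Icc x (u 0)) + eVariationOn w (Icc (u 0) (u n)) +
      eVariationOn w (Icc (u n) y) = eVariationOn w (Icc x y) := by
    have e1 := eVariationOn.Icc_add_Icc w (s := univ) (hus 0).1 (hu n.zero_le) trivial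
    have e2 := eVariationOn.Icc_add_Icc w (s := univ) (hus n).1 (hus n).2 trivial
    simp only [univ_inter] at e1 e2
    rw [e1, e2]
  rw [← h5]
  calc edist (m x) (m y) + ∑ i ∈ Finset.range n, edist (v (u (i + 1))) (v (u i))
      ≤ (edist (m x) (m (u 0)) + edist (m (u 0)) (m (u n)) + edist (m (u n)) (m y)) +
        ∑ i ∈ Finset.range n, edist (v (u (i + 1))) (v (u i)) := by
        gcongr
        exact edist_triangle4 _ _ _ _
    _ ≤ (edist (w x) (w (u 0)) + ∑ i ∈ Finset.range n, edist (m (u (i + 1))) (m (u i)) +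
          edist (w (u n)) (w y)) + ∑ i ∈ Finset.range n, edist (v (u (i + 1))) (v (u i)) := by
        gcongr
        exacts [hm _ _, h1 n, hm _ _]
    _ = edist (w x) (w (u 0)) + ∑ i ∈ Finset.range n, edist (w (u (i + 1))) (w (u i)) +
          edist (w (u n)) (w y) := by
        simp only [he, Finset.sum_add_distrib]
        ring
    _ ≤ _ := by gcongr

lemma abs_sub_eq_abs_truncation_add (w : ℝ → ℝ) (ε x y : ℝ) :
    |w x - w y| = |max (w x - ε) 0 - max (w y - ε) 0| + |min (w x) ε - min (w y) ε| := by
  rcases le_total (w x) ε with hx | hx <;> rcases le_total (w y) ε with hy | hy <;>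
    rcases le_total (w x) (w y) with h | h <;>
    simp only [hx, hy, min_eq_left, min_eq_right, max_eq_left, max_eq_right, sub_nonneg,
      sub_nonpos] <;>
    grind

lemma exists_eVariationOn_le_truncation_add {w : ℝ → ℝ} {s : Set ℝ} (hw : ∀ x, 0 ≤ w x)
    (hbv : BoundedVariationOn w s) {η : ℝ} (hη : 0 < η) :
    ∃ ε > 0, eVariationOn w s ≤
      eVariationOn (fun x => max (w x - ε) 0) s + ENNReal.ofReal η := by
  rcases eq_or_ne (eVariationOn w s) 0 with h0 | h0
  · exact ⟨1, one_pos, by simp [h0]⟩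
  have hlt : eVariationOn w s - ENNReal.ofReal (η / 2) < eVariationOn w s :=
    ENNReal.sub_lt_self hbv h0 (by simpa using hη)
  conv_rhs at hlt => rw [eVariationOn]
  obtain ⟨⟨n, u, hu, hus⟩, hlt⟩ := lt_iSup_iff.1 hlt
  refine ⟨η / (2 * (n + 1)), by positivity, ?_⟩
  set ε := η / (2 * ((n : ℝ) + 1)) with hε
  have hε0 : 0 < ε := by positivity
  have h1 : ∀ x y, edist (w x) (w y) ≤
      edist (max (w x - ε) 0) (max (w y - ε) 0) + ENNReal.ofReal ε := fun x y => by
    simp only [edist_dist, Real.dist_eq]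
    rw [← ENNReal.ofReal_add (abs_nonneg _) hε0.le]
    refine ENNReal.ofReal_le_ofReal ?_
    rw [abs_sub_eq_abs_truncation_add w ε]
    gcongr
    rw [abs_le]
    constructor <;> linarith [min_le_right (w x) ε, min_le_right (w y) ε,
      le_min (hw x) hε0.le, le_min (hw y) hε0.le]
  have h2 : (n : ENNReal) * ENNReal.ofReal ε ≤ ENNReal.ofReal (η / 2) := by
    rw [← ENNReal.ofReal_natCast, ← ENNReal.ofReal_mul (by positivity)]
    refine ENNReal.ofReal_le_ofReal ?_
    rw [hε, ← mul_div_assoc, div_le_div_iff₀ (by positivity) (by positivity)]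
    nlinarith
  have h3 := tsub_le_iff_right.1 hlt.le
  refine h3.trans ?_
  calc _ ≤ (eVariationOn (fun x => max (w x - ε) 0) s + ENNReal.ofReal (η / 2)) +
        ENNReal.ofReal (η / 2) := by
        gcongr
        refine (Finset.sum_le_sum fun i _ => h1 (u (i + 1)) (u i)).trans ?_
        rw [Finset.sum_add_distrib, Finset.sum_const, Finset.card_range, nsmul_eq_mul]
        gcongr
        exact eVariationOn.sum_le (f := fun x => max (w x - ε) 0) hu hus
    _ = _ := by
        rw [add_assoc, ← ENNReal.ofReal_add (by positivity) (by positivity), add_halves]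

/-- A nonnegative function of bounded variation is absolutely continuous if all its truncations
from below are. -/
theorem absolutelyContinuousOnInterval_of_truncation {w : ℝ → ℝ} {a b : ℝ} (hab : a ≤ b)
    (hw : ∀ x, 0 ≤ w x) (hbv : BoundedVariationOn w (Icc a b))
    (h : ∀ ε > 0, AbsolutelyContinuousOnInterval (fun x => max (w x - ε) 0) a b) :
    AbsolutelyContinuousOnInterval w a b := by
  rw [absolutelyContinuousOnInterval_iff]
  intro η hη
  obtain ⟨ε, hε, hvar⟩ := exists_eVariationOn_le_truncation_add hw hbv (half_pos hη)
  set v : ℝ → ℝ := fun x => max (w x - ε) 0 with hv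
  set m : ℝ → ℝ := fun x => min (w x) ε with hm
  have hwvm : ∀ x y, |w x - w y| = |v x - v y| + |m x - m y| :=
    abs_sub_eq_abs_truncation_add w ε
  have hvbv : BoundedVariationOn v (Icc a b) := by
    have := (h ε hε).boundedVariationOn
    rwa [uIcc_of_le hab] at this
  obtain ⟨δ, hδ, hlen⟩ := (absolutelyContinuousOnInterval_iff _ _ _).1 (h ε hε) _ (half_pos hη)
  refine ⟨δ, hδ, fun E hE hEδ => ?_⟩
  have ha : a ∈ Icc a b := ⟨le_rfl, hab⟩
  have hb : b ∈ Icc a b := ⟨hab, le_rfl⟩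
  set D : ℝ → ℝ := fun x => (eVariationOn w (Icc a x)).toReal - (eVariationOn v (Icc a x)).toReal
    with hD
  have hfin : ∀ {g : ℝ → ℝ}, BoundedVariationOn g (Icc a b) → ∀ {x y}, a ≤ x → y ≤ b →
      eVariationOn g (Icc x y) ≠ ⊤ := fun hg x y hx hy => hg.mono (Icc_subset_Icc hx hy)
  have hadd : ∀ {g : ℝ → ℝ}, BoundedVariationOn g (Icc a b) → ∀ {x y}, a ≤ x → x ≤ y → y ≤ b →
      (eVariationOn g (Icc a y)).toReal =
        (eVariationOn g (Icc a x)).toReal + (eVariationOn g (Icc x y)).toReal := by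
    intro g hg x y hx hxy hy
    have := eVariationOn.Icc_add_Icc g (s := univ) hx hxy trivial
    simp only [univ_inter] at this
    rw [← this, ENNReal.toReal_add (hfin hg le_rfl (hxy.trans hy)) (hfin hg hx hy)]
  have hinc : ∀ x y, a ≤ x → x ≤ y → y ≤ b → dist (m x) (m y) ≤ D y - D x := by
    intro x y hx hxy hy
    have h1 := ENNReal.toReal_mono (hfin hbv hx hy) (edist_add_eVariationOn_le hwvm hxy)
    rw [ENNReal.toReal_add (edist_ne_top _ _) (hfin hvbv hx hy), ← dist_edist] at h1
    simp only [hD]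
    rw [hadd hbv hx hxy hy, hadd hvbv hx hxy hy]
    linarith
  have hDmono : MonotoneOn D (Icc a b) := fun x hx y hy hxy => by
    linarith [hinc x y hx.1 hxy hy.2, dist_nonneg (x := m x) (y := m y)]
  have hDab : D b - D a ≤ η / 2 := by
    have h1 := ENNReal.toReal_mono (ENNReal.add_ne_top.2 ⟨hvbv, ENNReal.ofReal_ne_top⟩) hvar
    rw [ENNReal.toReal_add hvbv ENNReal.ofReal_ne_top, ENNReal.toReal_ofReal (half_pos hη).le] at h1
    simp only [hD, Icc_self, eVariationOn.subsingleton _ subsingleton_singleton]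
    simp only [ENNReal.toReal_zero]
    linarith
  obtain ⟨hmem, hdisj⟩ := hE
  rw [uIcc_of_le hab] at hmem
  have hm_sum : ∑ i ∈ Finset.range E.1, dist (m (E.2 i).1) (m (E.2 i).2) ≤ η / 2 := by
    have hle := sum_sub_le_of_nonoverlapping hab hDmono
      ((Finset.range E.1).filter fun i => (E.2 i).1 ≠ (E.2 i).2)
      (fun i => min (E.2 i).1 (E.2 i).2) (fun i => max (E.2 i).1 (E.2 i).2)
      (fun i hi => min_lt_max.2 (Finset.mem_filter.1 hi).2)
      (fun i hi => le_min (hmem i (Finset.mem_filter.1 hi).1).1.1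
        (hmem i (Finset.mem_filter.1 hi).1).2.1)
      (fun i hi => max_le (hmem i (Finset.mem_filter.1 hi).1).1.2
        (hmem i (Finset.mem_filter.1 hi).1).2.2)
      (fun i hi j hj hij => by
        obtain ⟨hi, hi'⟩ := Finset.mem_filter.1 hi
        obtain ⟨hj, hj'⟩ := Finset.mem_filter.1 hj
        have := hdisj hi hj hij
        simp only [Function.onFun, uIoc, Ioc_disjoint_Ioc] at this
        have h1 := min_lt_max.2 hi'
        have h2 := min_lt_max.2 hj'
        rcases min_le_iff.1 this with h | h <;> rcases le_max_iff.1 h with h | h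
        · exact absurd h (not_le.2 h1)
        · exact Or.inl h
        · exact Or.inr h
        · exact absurd h (not_le.2 h2))
    refine le_trans ?_ (hle.trans hDab)
    rw [Finset.sum_filter]
    refine Finset.sum_le_sum fun i hi => ?_
    obtain ⟨h1, h2⟩ := hmem i hi
    split_ifs with hne
    · rcases le_total (E.2 i).1 (E.2 i).2 with h | h
      · rw [min_eq_left h, max_eq_right h]
        exact hinc _ _ h1.1 h h2.2
      · rw [min_eq_right h, max_eq_left h, dist_comm]
        exact hinc _ _ h2.1 h h1.2
    · rw [not_not.1 hne, dist_self]
  calc ∑ i ∈ Finset.range E.1, dist (w (E.2 i).1) (w (E.2 i).2)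
      = ∑ i ∈ Finset.range E.1, dist (v (E.2 i).1) (v (E.2 i).2) +
        ∑ i ∈ Finset.range E.1, dist (m (E.2 i).1) (m (E.2 i).2) := by
        simp only [Real.dist_eq, hwvm, Finset.sum_add_distrib]
    _ < η / 2 + η / 2 := add_lt_add_of_lt_of_le (hlen E ⟨by rwa [uIcc_of_le hab], hdisj⟩ hEδ) hm_sum
    _ = η := add_halves η

lemma absolutelyContinuousOnInterval_of_abs_sub_le {u v : ℝ → ℝ} {a b L : ℝ}
    (hv : AbsolutelyContinuousOnInterval v a b)
    (h : ∀ x ∈ uIcc a b, ∀ y ∈ uIcc a b, |u x - u y| ≤ L * |x - y| + |v x - v y|) :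
    AbsolutelyContinuousOnInterval u a b := by
  have hid : AbsolutelyContinuousOnInterval (fun x : ℝ => x) a b :=
    LipschitzOnWith.absolutelyContinuousOnInterval (K := 1) LipschitzWith.id.lipschitzOnWith
  unfold AbsolutelyContinuousOnInterval at hid hv ⊢
  refine squeeze_zero' (Eventually.of_forall fun E => Finset.sum_nonneg fun _ _ => dist_nonneg) ?_
    (by simpa using (Tendsto.const_mul L hid).add hv)
  refine eventually_inf_principal.2 (Eventually.of_forall fun E hE => ?_)
  rw [Finset.mul_sum, ← Finset.sum_add_distrib]
  exact Finset.sum_le_sum fun i hi => h _ (hE.1 i hi).1 _ (hE.1 i hi).2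

lemma boundedVariationOn_sub {u v : ℝ → ℝ} {s : Set ℝ} (hu : BoundedVariationOn u s)
    (hv : BoundedVariationOn v s) : BoundedVariationOn (fun x => u x - v x) s := by
  refine ne_top_of_le_ne_top (ENNReal.add_ne_top.2 ⟨hu, hv⟩) (iSup_le ?_)
  rintro ⟨n, p, hp, hps⟩
  refine (Finset.sum_le_sum (g := fun i => edist (u (p (i + 1))) (u (p i)) +
    edist (v (p (i + 1))) (v (p i))) fun i _ => ?_).trans ?_
  · simp only [edist_dist]
    rw [← ENNReal.ofReal_add dist_nonneg dist_nonneg]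
    exact ENNReal.ofReal_le_ofReal (dist_sub_sub_le _ _ _ _)
  · rw [Finset.sum_add_distrib]
    exact add_le_add (eVariationOn.sum_le hp hps) (eVariationOn.sum_le hp hps)

section NtMax

variable {f : ℝ → ℝ} {α C : ℝ}

lemma avgAbs_sub_le_avgAbs_add (hc : Continuous f) (hC : ∀ x, |f x| ≤ C) (y h : ℝ) {t : ℝ}
    (ht : 0 < t) : avgAbs f y t - C / t * |h| ≤ avgAbs f (y + h) t := by
  have hi : ∀ a b, IntervalIntegrable (fun s => |f s|) volume a b := fun a b =>
    hc.abs.intervalIntegrable a b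
  have hend : ∀ z, |(∫ s in z..(z + h), |f s|)| ≤ C * |h| := fun z => by
    have := intervalIntegral.norm_integral_le_of_norm_le_const (a := z) (b := z + h)
      (f := fun s => |f s|) (C := C) fun s _ => by simpa using hC s
    simpa using this
  have h1 := intervalIntegral.integral_add_adjacent_intervals (hi (y - t) (y - t + h))
    (hi (y - t + h) (y + t))
  have h2 := intervalIntegral.integral_add_adjacent_intervals (hi (y - t + h) (y + t))
    (hi (y + t) (y + t + h))
  have h3 := integral_eq_avgAbs f (y + h) ht
  rw [show y + h - t = y - t + h by ring, show y + h + t = y + t + h by ring] at h3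
  rw [integral_eq_avgAbs f y ht] at h1
  have e1 := abs_le.1 (hend (y - t))
  have e2 := abs_le.1 (hend (y + t))
  have : t * (C / t * |h|) = C * |h| := by field_simp
  refine le_of_mul_le_mul_left ?_ (show 0 < 2 * t by linarith)
  rw [mul_sub]
  linarith

/-- Above any level strictly larger than `|f|`, the maximal function is Lipschitz. -/
lemma exists_truncated_ntMax_le (hα : 0 ≤ α) (hc : Continuous f) (hC : ∀ x, |f x| ≤ C) (a b : ℝ)
    {ε : ℝ} (hε : 0 < ε) :
    ∃ L, ∀ x ∈ Icc a b, ∀ y, |f x| + ε < ntMax α f x → ntMax α f x - L * |x - y| ≤ ntMax α f y := by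
  have huc : UniformContinuousOn (fun x => |f x|) (Icc (a - 1) (b + 1)) :=
    isCompact_Icc.uniformContinuousOn_of_continuous hc.abs.continuousOn
  obtain ⟨δ, hδ, hfδ⟩ := Metric.uniformContinuousOn_iff_le.1 huc ε hε
  set τ := min δ 1 / (1 + α) with hτ
  have hτ0 : 0 < τ := by positivity
  have hC0 : 0 ≤ C := (abs_nonneg _).trans (hC 0)
  refine ⟨C / τ, fun x hx y hxM => le_of_forall_lt fun c hc' => ?_⟩
  obtain ⟨z, t, ht, hxz, hlt⟩ := exists_lt_avgAbs (f := f) hα (x := x)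
    (c := max (|f x| + ε) (c + C / τ * |x - y|)) (max_lt hxM (by linarith))
  obtain ⟨hlt₁, hlt₂⟩ := max_lt_iff.1 hlt
  have hz := abs_le.1 hxz
  have hτt : τ ≤ t := by
    by_contra! htτ
    rw [hτ, lt_div_iff₀ (by positivity)] at htτ
    have m1 := min_le_left δ 1
    have m2 := min_le_right δ 1
    refine absurd (avgAbs_le_of_forall_le hc (y := z) (c := |f x| + ε) ht fun s hs => ?_)
      (not_le.2 hlt₁)
    have hsx : |s - x| ≤ t * (1 + α) := by
      rw [abs_le]; constructor <;> linarith [hs.1, hs.2]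
    have hsx' := abs_le.1 hsx
    have := hfδ s ⟨by linarith [hx.1], by linarith [hx.2]⟩ x ⟨by linarith [hx.1], by linarith [hx.2]⟩
      (by rw [Real.dist_eq]; linarith)
    rw [Real.dist_eq] at this
    linarith [(abs_le.1 this).2]
  have h1 := avgAbs_sub_le_avgAbs_add hc hC z (y - x) ht
  have h2 : avgAbs f (z + (y - x)) t ≤ ntMax α f y :=
    avgAbs_le_ntMax hc hC ht (by rwa [show y - (z + (y - x)) = x - z by ring])
  have h3 : C / t * |y - x| ≤ C / τ * |x - y| := by
    rw [abs_sub_comm]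
    gcongr
  linarith

lemma absolutelyContinuousOnInterval_truncated_ntMax (hα : 0 ≤ α) (hc : Continuous f)
    (hC : ∀ x, |f x| ≤ C) {a b ε : ℝ} (hab : a ≤ b) (hε : 0 < ε)
    (hf : AbsolutelyContinuousOnInterval (fun x => |f x|) a b) :
    AbsolutelyContinuousOnInterval (fun x => max (ntMax α f x - |f x| - ε) 0) a b := by
  obtain ⟨L, hL⟩ := exists_truncated_ntMax_le hα hc hC a b hε
  have key : ∀ x ∈ Icc a b, ∀ y, max (ntMax α f x - |f x| - ε) 0 -
      max (ntMax α f y - |f y| - ε) 0 ≤ max L 0 * |x - y| + |(|f x| - |f y|)| := by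
    intro x hx y
    have hnn : 0 ≤ max L 0 * |x - y| := by positivity
    rcases le_or_gt (ntMax α f x - |f x| - ε) 0 with h | h
    · rw [max_eq_right h]
      linarith [le_max_right (ntMax α f y - |f y| - ε) 0, abs_nonneg (|f x| - |f y|)]
    · rw [max_eq_left h.le]
      have h1 := hL x hx y (by linarith)
      have h2 : L * |x - y| ≤ max L 0 * |x - y| := by gcongr; exact le_max_left _ _
      linarith [le_max_left (ntMax α f y - |f y| - ε) 0, neg_abs_le (|f x| - |f y|)]
  refine absolutelyContinuousOnInterval_of_abs_sub_le hf (L := max L 0) fun x hx y hy => ?_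
  rw [uIcc_of_le hab] at hx hy
  refine abs_le.2 ⟨?_, key x hx y⟩
  have := key y hy x
  rw [abs_sub_comm y x, abs_sub_comm |f y|] at this
  linarith

/-- The nontangential maximal function of a bounded continuous function of bounded variation
is absolutely continuous wherever the modulus of the function is. -/
theorem absolutelyContinuousOnInterval_ntMax (hα : 0 ≤ α) (hc : Continuous f)
    (hC : ∀ x, |f x| ≤ C) {V : ℝ → ℝ} {B : ℝ}
    (hV : ∀ x y, x ≤ y → |(|f x| - |f y|)| ≤ V y - V x) (hV0 : ∀ x, 0 ≤ V x) (hB : ∀ x, V x ≤ B)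
    {a b : ℝ} (hab : a ≤ b) (hf : AbsolutelyContinuousOnInterval (fun x => |f x|) a b) :
    AbsolutelyContinuousOnInterval (ntMax α f) a b := by
  have hbv : BoundedVariationOn (fun x => ntMax α f x - |f x|) (Icc a b) := by
    have h1 := hf.boundedVariationOn
    rw [uIcc_of_le hab] at h1
    exact boundedVariationOn_sub ((boundedVariationOn_ntMax hα hc hC hV hV0 hB).mono
      (subset_univ _)) h1
  have := (absolutelyContinuousOnInterval_of_truncation hab
    (fun x => sub_nonneg.2 (abs_le_ntMax hα hc hC x)) hbv fun ε hε =>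
      absolutelyContinuousOnInterval_truncated_ntMax hα hc hC hab hε hf).fun_add hf
  simpa using this

end NtMax

end MaximalVariation

open MaximalVariation

/-- Let `α ≥ 0` and let `f ∈ W^{1,1}(ℝ)`, i.e. `f` is an absolutely continuous integrable
function whose (weak) derivative `f'` is integrable, which we express by the fundamental
theorem of calculus with an integrable density `f'`. Then `M^α f ∈ W^{1,1}_loc(ℝ)`:
`M^α f` is absolutely continuous on every compact interval, i.e. on each `[a, b]` it is given
by the integral of an integrable density. -/
theorem ntMax_absolutelyContinuous_of_W11 (α : ℝ) (hα : 0 ≤ α) (f f' : ℝ → ℝ)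
    (hf : MeasureTheory.Integrable f) (hf' : MeasureTheory.Integrable f')
    (hftc : ∀ a b : ℝ, f b - f a = ∫ t in a..b, f' t) :
    ∀ a b : ℝ, ∃ g : ℝ → ℝ, MeasureTheory.IntegrableOn g (Set.Icc a b) ∧
      ∀ x ∈ Set.Icc a b, ntMax α f x = ntMax α f a + ∫ t in a..x, g t := by
  intro a b
  rcases lt_or_ge b a with hba | hab
  · exact ⟨0, by simp [Icc_eq_empty_of_lt hba], by simp [Icc_eq_empty_of_lt hba]⟩
  have hfun : ∀ c, f = fun x => f c + ∫ t in c..x, f' t := fun c => by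
    ext x; rw [← hftc]; ring
  have hc : Continuous f := by
    rw [hfun 0]
    exact continuous_const.add
      (intervalIntegral.continuous_primitive (fun _ _ => hf'.intervalIntegrable) 0)
  have hV : ∀ x y, x ≤ y →
      |f x - f y| ≤ (∫ t in Iic y, |f' t|) - ∫ t in Iic x, |f' t| := by
    intro x y hxy
    rw [intervalIntegral.integral_Iic_sub_Iic hf'.abs.integrableOn hf'.abs.integrableOn,
      abs_sub_comm, hftc]
    exact intervalIntegral.abs_integral_le_integral_abs hxy
  have hV0 : ∀ x, 0 ≤ ∫ t in Iic x, |f' t| := fun x => integral_nonneg fun _ => abs_nonneg _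
  have hB : ∀ x, ∫ t in Iic x, |f' t| ≤ ∫ t, |f' t| := fun x =>
    setIntegral_le_integral hf'.abs (Eventually.of_forall fun _ => abs_nonneg _)
  have hC : ∀ x, |f x| ≤ |f 0| + ∫ t, |f' t| := by
    intro x
    have h : |f x - f 0| ≤ ∫ t, |f' t| := by
      rcases le_total x 0 with h | h
      · linarith [hV x 0 h, hV0 x, hB 0]
      · rw [abs_sub_comm]
        linarith [hV 0 x h, hV0 0, hB x]
    linarith [abs_sub_abs_le_abs_sub (f x) (f 0)]
  have hfac : AbsolutelyContinuousOnInterval f a b := by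
    refine absolutelyContinuousOnInterval_of_abs_sub_le (L := 0)
      ((hf'.intervalIntegrable (a := a) (b := b)).absolutelyContinuousOnInterval_intervalIntegral
        left_mem_uIcc) fun x _ y _ => ?_
    simp only [← hftc]
    simp
  have hac : AbsolutelyContinuousOnInterval (ntMax α f) a b :=
    absolutelyContinuousOnInterval_ntMax hα hc hC
      (fun x y hxy => (abs_abs_sub_abs_le_abs_sub _ _).trans (hV x y hxy)) hV0 hB hab
      (absolutelyContinuousOnInterval_of_abs_sub_le (L := 0) hfac fun x _ y _ => by
        simpa using abs_abs_sub_abs_le_abs_sub (f x) (f y))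
  refine ⟨deriv (ntMax α f), (intervalIntegrable_iff_integrableOn_Icc_of_le hab).1
    hac.intervalIntegrable_deriv, fun x hx => ?_⟩
  have hsub : uIcc a x ⊆ uIcc a b := by
    rw [uIcc_of_le hx.1, uIcc_of_le hab]
    exact Icc_subset_Icc le_rfl hx.2
  rw [(hac.mono hsub).integral_deriv_eq_sub]
  ring
end
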